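/- Let n ≥ 5 and let G be a connected simple graph on n vertices having at least one non-complete block. Then Sz(G)/W(G) ≥ 1 + 12/(n³ − 19n + 54), with equality if and only if G is isomorphic to B_n^{(1)}. -/

import Mathlib

open SimpleGraph Finset
open scoped Classical

noncomputable section

/-- The Wiener index of a graph, as a rational number: half of the sum of
distances over all ordered pairs of vertices (i.e. the sum over unordered pairs). -/
def wienerIndex {V : Type*} [Fintype V] (G : SimpleGraph V) : ℚ :=
  (∑ u : V, ∑ v : V, (G.dist u v : ℚ)) / 2

/-- The transmission `D_G(v)` of a vertex: the sum of distances to all vertices. -/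
def transmission {V : Type*} [Fintype V] (G : SimpleGraph V) (v : V) : ℚ :=
  ∑ x : V, (G.dist x v : ℚ)

/-- `n_u(e)` for `e = uv`: the number of vertices strictly closer to `u` than to `v`. -/
def nCloser {V : Type*} [Fintype V] (G : SimpleGraph V) (u v : V) : ℕ :=
  (Finset.univ.filter fun w => G.dist u w < G.dist v w).card

/-- `n_0(e)` for `e = uv`: the number of vertices equidistant from `u` and `v`. -/
def nEqual {V : Type*} [Fintype V] (G : SimpleGraph V) (u v : V) : ℕ :=
  (Finset.univ.filter fun w => G.dist u w = G.dist v w).card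

/-- The Szeged index, as a rational number (each edge is counted once). -/
def szeged {V : Type*} [Fintype V] (G : SimpleGraph V) : ℚ :=
  (∑ u : V, ∑ v : V,
    if G.Adj u v then (nCloser G u v : ℚ) * (nCloser G v u : ℚ) else 0) / 2

/-- The revised Szeged index, as a rational number (each edge is counted once). -/
def szegedStar {V : Type*} [Fintype V] (G : SimpleGraph V) : ℚ :=
  (∑ u : V, ∑ v : V,
    if G.Adj u v then
      ((nCloser G u v : ℚ) + (nEqual G u v : ℚ) / 2) *
        ((nCloser G v u : ℚ) + (nEqual G u v : ℚ) / 2)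
    else 0) / 2

/-- The cycle `C_k` on the vertices `0, 1, …, k-1`. -/
def cycleG (k : ℕ) : SimpleGraph (Fin k) :=
  SimpleGraph.fromRel (fun a b => a.val + 1 = b.val ∨ (a.val = 0 ∧ b.val = k - 1))

/-- The lollipop `L_{n,r}`: the cycle `C_r` on `0, …, r-1` together with the
path `r-1, r, …, n-1` attached at the cycle vertex `r-1`. -/
def lollipop (n r : ℕ) : SimpleGraph (Fin n) :=
  SimpleGraph.fromRel (fun a b => a.val + 1 = b.val ∨ (a.val = 0 ∧ b.val = r - 1))

/-- `H_n^0`: a triangle `0,1,2`, a path `2, 3, …, n-3` (so `u_1 = 2`, `u_{n-4} = n-3`)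
and two pendant vertices `n-2, n-1` attached at `n-3`. -/
def Hgraph0 (n : ℕ) : SimpleGraph (Fin n) :=
  SimpleGraph.fromRel (fun a b =>
    (a.val + 1 = b.val ∧ b.val ≤ n - 2) ∨ (a.val = 0 ∧ b.val = 2) ∨
    (a.val = n - 3 ∧ b.val = n - 1))

/-- `H_n^1`: a triangle `0,1,2`, a path `2, 3, …, n-4` (so `u_1 = 2`, `u_{n-5} = n-4`),
a path of length two `n-4, n-3, n-2` and a pendant vertex `n-1` attached at `n-4`. -/
def Hgraph1 (n : ℕ) : SimpleGraph (Fin n) :=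
  SimpleGraph.fromRel (fun a b =>
    (a.val + 1 = b.val ∧ b.val ≤ n - 2) ∨ (a.val = 0 ∧ b.val = 2) ∨
    (a.val = n - 4 ∧ b.val = n - 1))

/-- `H_n^2`: a `4`-cycle `0,1,2,3`, a path `3, 4, …, n-3` (so `u_1 = 3`, `u_{n-5} = n-3`)
and two pendant vertices `n-2, n-1` attached at `n-3`. -/
def Hgraph2 (n : ℕ) : SimpleGraph (Fin n) :=
  SimpleGraph.fromRel (fun a b =>
    (a.val + 1 = b.val ∧ b.val ≤ n - 2) ∨ (a.val = 0 ∧ b.val = 3) ∨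
    (a.val = n - 3 ∧ b.val = n - 1))

/-- `H_n^3`: a triangle `0,1,2`, a path `2, 3, …, n-4` (so `u_1 = 2`, `u_{n-5} = n-4`),
two pendant vertices `n-3, n-2` attached at `n-4`, and a pendant vertex `n-1`
attached at the second triangle vertex `0`. -/
def Hgraph3 (n : ℕ) : SimpleGraph (Fin n) :=
  SimpleGraph.fromRel (fun a b =>
    (a.val + 1 = b.val ∧ b.val ≤ n - 3) ∨ (a.val = 0 ∧ b.val = 2) ∨
    (a.val = n - 4 ∧ b.val = n - 2) ∨ (a.val = 0 ∧ b.val = n - 1))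

/-- `B(n,s)`: `K_4^-` on the vertices `x = n-s-4`, `u = n-s-3`, `y = n-s-2`, `v = n-1`
(with the edge `xy` missing), a path on `n-s-4` vertices `0, …, n-s-5` attached at `x`,
and a path on `s` vertices `n-s-1, …, n-2` attached at `y`. -/
def Bgraph (n s : ℕ) : SimpleGraph (Fin n) :=
  SimpleGraph.fromRel (fun a b =>
    (a.val + 1 = b.val ∧ b.val ≤ n - 2) ∨
    (b.val = n - 1 ∧ (a.val = n - s - 4 ∨ a.val = n - s - 3 ∨ a.val = n - s - 2)))

/-- `B_n^{(1)}`: `K_4^-` on the vertices `n-4, n-3, n-2, n-1` (with the edge between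
`n-2` and `n-1` missing), with an end-vertex of the path `0, 1, …, n-4` identified with
the degree-`3` vertex `n-4` of `K_4^-`. -/
def Bn1 (n : ℕ) : SimpleGraph (Fin n) :=
  SimpleGraph.fromRel (fun a b =>
    (a.val + 1 = b.val ∧ b.val ≤ n - 3) ∨
    (a.val = n - 4 ∧ b.val = n - 2) ∨ (a.val = n - 4 ∧ b.val = n - 1) ∨
    (a.val = n - 3 ∧ b.val = n - 2) ∨ (a.val = n - 3 ∧ b.val = n - 1))

/-- `B_n^{3,3}`: two triangles `0,1,2` and `n-3,n-2,n-1` joined by the path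
`2, 3, …, n-3` of length `n-5`. -/
def B33 (n : ℕ) : SimpleGraph (Fin n) :=
  SimpleGraph.fromRel (fun a b =>
    a.val + 1 = b.val ∨ (a.val = 0 ∧ b.val = 2) ∨ (a.val = n - 3 ∧ b.val = n - 1))

/-- `C_r(P_{m 0 + 1}, …, P_{m (r-1) + 1})`: the unicyclic graph obtained from the cycle
`C_r` by identifying, for each `i`, one end-vertex of a path on `m i + 1` vertices with
the `i`-th cycle vertex.  The vertex `⟨i, 0⟩` is the cycle vertex `v_i`, and `⟨i, j⟩`
for `j ≥ 1` are the remaining vertices of the path attached at `v_i`. -/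
def cyclePaths (r : ℕ) (m : Fin r → ℕ) : SimpleGraph (Σ i : Fin r, Fin (m i + 1)) :=
  SimpleGraph.fromRel (fun a b =>
    (a.2.val = 0 ∧ b.2.val = 0 ∧ (a.1.val + 1) % r = b.1.val) ∨
    (a.1 = b.1 ∧ a.2.val + 1 = b.2.val))

/-- The graph obtained from vertex-disjoint graphs `G₁`, `G₂` by identifying the
vertex `v₁` of `G₁` with the vertex `v₂` of `G₂`; the common vertex is `Sum.inl v₁`. -/
def glue {V₁ V₂ : Type*} (G₁ : SimpleGraph V₁) (G₂ : SimpleGraph V₂) (v₁ : V₁) (v₂ : V₂) :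
    SimpleGraph (V₁ ⊕ {x : V₂ // x ≠ v₂}) :=
  SimpleGraph.fromRel (fun a b =>
    match a, b with
    | Sum.inl a, Sum.inl b => G₁.Adj a b
    | Sum.inr a, Sum.inr b => G₂.Adj a.val b.val
    | Sum.inl a, Sum.inr b => a = v₁ ∧ G₂.Adj v₂ b.val
    | Sum.inr _, Sum.inl _ => False)

/-- The spider `A_{n,4}`: a center `n-5` with one leg `n-5, n-6, …, 0` of length
`n-5` and four legs of length one ending at the unit leaves `n-4, n-3, n-2, n-1`;
the non-unit leaf is the vertex `0`. -/
def spiderA (n : ℕ) : SimpleGraph (Fin n) :=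
  SimpleGraph.fromRel (fun a b =>
    (a.val + 1 = b.val ∧ b.val ≤ n - 5) ∨ (a.val = n - 5 ∧ n - 4 ≤ b.val))

/-- The theta graph `B_{k,l,t}` on `k + l + t - 1` vertices: the vertices `u = 0` and
`w = k` joined by three internally disjoint paths of lengths `k`, `l`, `t`, with
internal vertices `1, …, k-1`, `k+1, …, k+l-1` and `k+l, …, k+l+t-2` respectively. -/
def theta (k l t : ℕ) : SimpleGraph (Fin (k + l + t - 1)) :=
  SimpleGraph.fromRel (fun a b =>
    (a.val + 1 = b.val ∧ b.val ≤ k) ∨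
    (a.val = 0 ∧ b.val = k + 1) ∨
    (a.val + 1 = b.val ∧ k + 1 ≤ a.val ∧ b.val ≤ k + l - 1) ∨
    (a.val = k ∧ b.val = k + l - 1) ∨
    (a.val = 0 ∧ b.val = k + l) ∨
    (a.val + 1 = b.val ∧ k + l ≤ a.val ∧ b.val ≤ k + l + t - 2) ∨
    (a.val = k ∧ b.val = k + l + t - 2))

/-- A set of vertices `B` induces a subgraph with no cut vertex. -/
def NoCutVtx {V : Type*} (G : SimpleGraph V) (B : Set V) : Prop :=
  ∀ v ∈ B, (G.induce (B \ {v})).Preconnected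

/-- `B` is (the vertex set of) a block of `G`: a maximal connected subgraph of `G`
without a cut vertex. -/
def IsBlock {V : Type*} (G : SimpleGraph V) (B : Set V) : Prop :=
  (G.induce B).Connected ∧ NoCutVtx G B ∧
  ∀ C : Set V, B ⊆ C → (G.induce C).Connected → NoCutVtx G C → C = B

section Distance

variable {V : Type*} {G : SimpleGraph V}

lemma dist_le_succ_of_adj (hG : G.Connected) {u v : V} (h : G.Adj u v) (x : V) :
    G.dist u x ≤ G.dist v x + 1 := by
  have := hG.dist_triangle (u := u) (v := v) (w := x)
  have := dist_eq_one_iff_adj.2 h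
  omega

lemma exists_adj_dist_eq (hG : G.Connected) {x y : V} {k : ℕ} (h : G.dist x y = k + 1) :
    ∃ z, G.Adj x z ∧ G.dist z y = k := by
  obtain ⟨p, hp⟩ := hG.exists_walk_length_eq_dist x y
  cases p with
  | nil => simp at h
  | cons hadj q =>
    refine ⟨_, hadj, ?_⟩
    have h1 := dist_le q
    have h2 := dist_le_succ_of_adj hG hadj y
    simp at hp
    omega

end Distance

section Excess

variable {V : Type*} [Fintype V] {G : SimpleGraph V}

/-- The oriented edges `(u, v)` such that `x` is closer to `u` and `y` is closer to `v`. -/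
def separatingEdges (G : SimpleGraph V) (x y : V) : Finset (V × V) :=
  univ.filter fun e => G.Adj e.1 e.2 ∧ G.dist e.1 x < G.dist e.2 x ∧ G.dist e.2 y < G.dist e.1 y

/-- The number of edges separating `x` from `y` in excess of their distance. -/
def excess (G : SimpleGraph V) (x y : V) : ℕ :=
  (separatingEdges G x y).card - G.dist x y

lemma mem_separatingEdges {x y u v : V} : (u, v) ∈ separatingEdges G x y ↔
    G.Adj u v ∧ G.dist u x < G.dist v x ∧ G.dist v y < G.dist u y := by
  simp [separatingEdges]

lemma exists_separatingEdge (hG : G.Connected) (x y : V) {k : ℕ} (hk : k < G.dist x y) :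
    ∃ e ∈ separatingEdges G x y, G.dist e.1 x = k := by
  have hvertex : ∀ k ≤ G.dist x y, ∃ u, G.dist u x = k ∧ G.dist u y + k = G.dist x y := by
    intro k
    induction k with
    | zero => exact fun _ => ⟨x, by simp⟩
    | succ k ih =>
      intro hk
      obtain ⟨u, h1, h2⟩ := ih (by omega)
      obtain ⟨v, h3, h4⟩ := exists_adj_dist_eq hG
        (show G.dist u y = (G.dist x y - k - 1) + 1 by omega)
      refine ⟨v, ?_, by omega⟩
      have := dist_le_succ_of_adj hG h3.symm x
      have := hG.dist_triangle (u := x) (v := v) (w := y)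
      rw [G.dist_comm (u := x) (v := v)] at this
      omega
  obtain ⟨u, h1, h2⟩ := hvertex k hk.le
  obtain ⟨v, h3, h4⟩ := exists_adj_dist_eq hG
    (show G.dist u y = (G.dist x y - k - 1) + 1 by omega)
  refine ⟨(u, v), mem_separatingEdges.2 ⟨h3, ?_, by omega⟩, h1⟩
  have := hG.dist_triangle (u := x) (v := v) (w := y)
  rw [G.dist_comm (u := x) (v := v)] at this
  omega

lemma dist_add_card_le (hG : G.Connected) {x y : V} {S : Finset (V × V)}
    (hS : S ⊆ separatingEdges G x y) :
    G.dist x y + S.card ≤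
      (separatingEdges G x y).card + (S.image fun e => G.dist e.1 x).card := by
  set T := S.image fun e => G.dist e.1 x
  have hch : ∀ k : ℕ, ∃ e : V × V, k < G.dist x y → e ∈ separatingEdges G x y ∧ G.dist e.1 x = k := by
    intro k
    by_cases hk : k < G.dist x y
    · obtain ⟨e, he⟩ := exists_separatingEdge hG x y hk
      exact ⟨e, fun _ => he⟩
    · exact ⟨(x, x), fun h => absurd h hk⟩
  choose f hf using hch
  have hR : ∀ k ∈ range (G.dist x y) \ T, k < G.dist x y ∧ k ∉ T := by
    intro k hk
    simpa using hk
  have hinj : Set.InjOn f (range (G.dist x y) \ T : Finset ℕ) := by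
    intro i hi j hj hij
    rw [← (hf i (hR i hi).1).2, hij, (hf j (hR j hj).1).2]
  have hdisj : Disjoint S ((range (G.dist x y) \ T).image f) := by
    rw [Finset.disjoint_right]
    intro e he heS
    obtain ⟨k, hk, rfl⟩ := Finset.mem_image.1 he
    exact (hR k hk).2 (Finset.mem_image.2 ⟨_, heS, (hf k (hR k hk).1).2⟩)
  have hsub : S ∪ (range (G.dist x y) \ T).image f ⊆ separatingEdges G x y := by
    refine Finset.union_subset hS fun e he => ?_
    obtain ⟨k, hk, rfl⟩ := Finset.mem_image.1 he
    exact (hf k (hR k hk).1).1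
  have h1 := Finset.card_le_card hsub
  rw [Finset.card_union_of_disjoint hdisj, Finset.card_image_of_injOn hinj] at h1
  have h2 := Finset.le_card_sdiff T (range (G.dist x y))
  rw [Finset.card_range] at h2
  omega

lemma dist_add_excess (hG : G.Connected) (x y : V) :
    G.dist x y + excess G x y = (separatingEdges G x y).card := by
  have := dist_add_card_le hG (Finset.empty_subset (separatingEdges G x y))
  simp at this
  simp only [excess]
  omega

lemma card_le_excess_add (hG : G.Connected) {x y : V} {S : Finset (V × V)}
    (hS : S ⊆ separatingEdges G x y) :
    S.card ≤ excess G x y + (S.image fun e => G.dist e.1 x).card := by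
  have := dist_add_card_le hG hS
  have := dist_add_excess hG x y
  omega

lemma excess_comm (x y : V) : excess G x y = excess G y x := by
  have : (separatingEdges G x y).card = (separatingEdges G y x).card := by
    refine Finset.card_bij (fun e _ => e.swap) ?_ ?_ ?_
    · rintro ⟨u, v⟩ h
      rw [mem_separatingEdges] at h
      exact mem_separatingEdges.2 ⟨h.1.symm, h.2.2, h.2.1⟩
    · intro e _ e' _ h
      exact Prod.swap_injective h
    · rintro ⟨u, v⟩ h
      rw [mem_separatingEdges] at h
      exact ⟨(v, u), mem_separatingEdges.2 ⟨h.1.symm, h.2.2, h.2.1⟩, rfl⟩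
  simp only [excess, this, G.dist_comm (u := x)]

lemma sum_card_separatingEdges (G : SimpleGraph V) :
    ∑ x, ∑ y, (separatingEdges G x y).card =
      ∑ u, ∑ v, if G.Adj u v then nCloser G u v * nCloser G v u else 0 := by
  have h1 : ∀ x y, (separatingEdges G x y).card = ∑ e : V × V,
      if G.Adj e.1 e.2 ∧ G.dist e.1 x < G.dist e.2 x ∧ G.dist e.2 y < G.dist e.1 y
        then 1 else 0 := by
    intro x y
    rw [separatingEdges, Finset.card_filter]
  simp only [h1]
  refine ((Finset.sum_congr rfl fun x _ => Finset.sum_comm).trans Finset.sum_comm).trans ?_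
  rw [Fintype.sum_prod_type]
  refine Finset.sum_congr rfl fun u _ => Finset.sum_congr rfl fun v _ => ?_
  by_cases h : G.Adj u v
  · simp only [h, true_and, if_true, nCloser, Finset.card_filter, Finset.sum_mul_sum]
    refine Finset.sum_congr rfl fun x _ => Finset.sum_congr rfl fun y _ => ?_
    by_cases h1 : G.dist u x < G.dist v x <;>
      by_cases h2 : G.dist v y < G.dist u y <;> simp [h1, h2]
  · simp [h]

lemma szeged_eq_wienerIndex_add (hG : G.Connected) :
    szeged G = wienerIndex G + (∑ x, ∑ y, (excess G x y : ℚ)) / 2 := by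
  have h : szeged G = (∑ x, ∑ y, ((separatingEdges G x y).card : ℚ)) / 2 := by
    have := congrArg (Nat.cast (R := ℚ)) (sum_card_separatingEdges G)
    push_cast at this
    rw [this]
    simp [szeged]
  rw [h, wienerIndex, ← add_div, ← Finset.sum_add_distrib]
  congr 1
  refine Finset.sum_congr rfl fun x _ => ?_
  rw [← Finset.sum_add_distrib]
  refine Finset.sum_congr rfl fun y _ => ?_
  rw [← dist_add_excess hG]
  push_cast
  rfl

lemma two_mul_excess_le (G : SimpleGraph V) {x y : V} (hxy : x ≠ y) :
    2 * excess G x y ≤ ∑ p : V × V, excess G p.1 p.2 := by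
  have h := Finset.sum_le_univ_sum_of_nonneg (s := {(x, y), (y, x)})
    (f := fun p : V × V => excess G p.1 p.2) (fun _ => Nat.zero_le _)
  rw [Finset.sum_pair (by simp [hxy])] at h
  simp only [excess_comm y x] at h
  omega

lemma two_mul_excess_add_excess_le (G : SimpleGraph V) {x y z w : V} (hxy : x ≠ y) (hzw : z ≠ w)
    (h₁ : ¬ (x = z ∧ y = w)) (h₂ : ¬ (x = w ∧ y = z)) :
    2 * (excess G x y + excess G z w) ≤ ∑ p : V × V, excess G p.1 p.2 := by
  have h := Finset.sum_le_univ_sum_of_nonneg (s := {(x, y), (y, x), (z, w), (w, z)})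
    (f := fun p : V × V => excess G p.1 p.2) (fun _ => Nat.zero_le _)
  rw [Finset.sum_insert, Finset.sum_insert, Finset.sum_pair] at h
  · simp only [excess_comm y x, excess_comm w z] at h
    omega
  all_goals simp only [mem_insert, Finset.mem_singleton, Prod.mk.injEq, ne_eq]
  all_goals grind

lemma two_mul_excess_add_excess_add_excess_le (G : SimpleGraph V) {y p q w : V} (hyp : y ≠ p)
    (hyq : y ≠ q) (hpq : p ≠ q) (hwy : w ≠ y) (hwp : w ≠ p) :
    2 * (excess G y p + excess G y q + excess G w p) ≤ ∑ p : V × V, excess G p.1 p.2 := by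
  have h := Finset.sum_le_univ_sum_of_nonneg
    (s := {(y, p), (p, y), (y, q), (q, y), (w, p), (p, w)})
    (f := fun p : V × V => excess G p.1 p.2) (fun _ => Nat.zero_le _)
  rw [Finset.sum_insert, Finset.sum_insert, Finset.sum_insert, Finset.sum_insert,
    Finset.sum_pair] at h
  · simp only [excess_comm p y, excess_comm q y, excess_comm p w] at h
    omega
  all_goals simp only [mem_insert, Finset.mem_singleton, Prod.mk.injEq, ne_eq]
  all_goals grind

end Excess

section Separation

variable {V : Type*} {G : SimpleGraph V}

/-- If geodesics are unique and the ends of every edge equidistant from a root share a parent,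
then two non-adjacent neighbours of `b` are separated by `b`. -/
lemma not_reachable_of_unique_parents (hG : G.Connected)
    (hU : ∀ x y p q, G.Adj x p → G.Adj x q → G.dist p y + 1 = G.dist x y →
      G.dist q y + 1 = G.dist x y → p = q)
    (hO : ∀ y p q k, G.Adj p q → G.dist p y = k + 2 → G.dist q y = k + 2 →
      ∃ z, G.Adj p z ∧ G.Adj q z ∧ G.dist z y = k + 1)
    {B : Set V} {b c d : V} (hcb : G.Adj c b) (hdb : G.Adj d b) (hcd : c ≠ d)
    (hncd : ¬ G.Adj c d) (hc : c ∈ B \ {b}) (hd : d ∈ B \ {b}) :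
    ¬ (G.induce (B \ {b})).Reachable ⟨c, hc⟩ ⟨d, hd⟩ := by
  let S : Set V := {x | ∃ a, G.Adj a b ∧ (a = c ∨ G.Adj a c) ∧ G.dist x b = G.dist x a + 1}
  have hup : ∀ x x', G.Adj x x' → x ∈ S → G.dist x' b = G.dist x b + 1 → x' ∈ S := by
    rintro x x' hadj ⟨a, hab, hac, h⟩ h'
    refine ⟨a, hab, hac, ?_⟩
    have h1 := dist_le_succ_of_adj hG hadj.symm a
    have h2 := hG.dist_triangle (u := x') (v := a) (w := b)
    have h3 := dist_eq_one_iff_adj.2 hab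
    omega
  have hdown : ∀ x x', G.Adj x x' → x ∈ S → x' ≠ b → G.dist x' b + 1 = G.dist x b → x' ∈ S := by
    rintro x x' hadj ⟨a, hab, hac, h⟩ hx'b h'
    have h1 := hG.pos_dist_of_ne hx'b
    obtain ⟨z, hxz, hz⟩ := exists_adj_dist_eq hG (show G.dist x a = (G.dist x' b - 1) + 1 by omega)
    have h2 := hG.dist_triangle (u := z) (v := a) (w := b)
    have h3 := dist_eq_one_iff_adj.2 hab
    have h4 := dist_le_succ_of_adj hG hxz b
    have : x' = z := hU x b _ _ hadj hxz h' (by omega)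
    subst this
    exact ⟨a, hab, hac, by omega⟩
  have hstep : ∀ x x', G.Adj x x' → x ∈ S → x' ≠ b → x' ∈ S := by
    intro x x' hadj hx hx'b
    have h1 := dist_le_succ_of_adj hG hadj b
    have h2 := dist_le_succ_of_adj hG hadj.symm b
    rcases (by omega : G.dist x' b = G.dist x b + 1 ∨ G.dist x' b + 1 = G.dist x b ∨
      G.dist x' b = G.dist x b) with h | h | h
    · exact hup x x' hadj hx h
    · exact hdown x x' hadj hx hx'b h
    · have h3 := hG.pos_dist_of_ne hx'b
      by_cases h4 : G.dist x' b = 1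
      · obtain ⟨a, hab, hac, hxa⟩ := hx
        have hxa' : x = a := hG.dist_eq_zero_iff.1 (by omega)
        subst hxa'
        refine ⟨x', dist_eq_one_iff_adj.1 h4, ?_, by simp [h4]⟩
        rcases hac with rfl | hac
        · exact Or.inr hadj.symm
        · by_contra! hcon
          have hx'b' := dist_eq_one_iff_adj.1 h4
          have h5 := hG.one_lt_dist_of_ne_of_not_adj hcon.1 hcon.2
          have h6 := dist_le_succ_of_adj hG hadj.symm c
          have h7 := dist_eq_one_iff_adj.2 hac
          have h8 := dist_eq_one_iff_adj.2 hcb.symm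
          exact hab.ne (hU x' c _ _ hadj.symm hx'b' (by omega) (by omega))
      · obtain ⟨z, hz1, hz2, hz⟩ := hO b x x' (G.dist x b - 2) hadj (by omega) (by omega)
        refine hup z x' hz2.symm (hdown x z hz1 hx ?_ (by omega)) (by omega)
        rintro rfl
        simp at hz
  rintro ⟨p⟩
  have hwalk : ∀ s t : ↥(B \ {b}), (G.induce (B \ {b})).Walk s t → s.1 ∈ S → t.1 ∈ S := by
    intro s t p
    induction p with
    | nil => exact id
    | @cons s m t h _ ih => exact fun hs => ih (hstep s.1 m.1 h hs m.2.2)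
  have hcS : c ∈ S := ⟨c, hcb, Or.inl rfl, by simp [dist_eq_one_iff_adj.2 hcb]⟩
  obtain ⟨a, hab, hac, h⟩ := hwalk _ _ p hcS
  rw [dist_eq_one_iff_adj.2 hdb] at h
  have : d = a := hG.dist_eq_zero_iff.1 (by simpa using h.symm)
  subst this
  rcases hac with h | h
  · exact hcd h.symm
  · exact hncd h.symm

lemma exists_induced_path_of_not_clique {B : Set V} (hB : (G.induce B).Connected)
    (hne : ¬ (∀ u ∈ B, ∀ v ∈ B, u ≠ v → G.Adj u v)) :
    ∃ c ∈ B, ∃ b ∈ B, ∃ d ∈ B, G.Adj c b ∧ G.Adj d b ∧ c ≠ d ∧ ¬ G.Adj c d := by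
  by_contra! hcon
  refine hne fun u hu v hv huv => ?_
  obtain ⟨p⟩ := hB.preconnected ⟨u, hu⟩ ⟨v, hv⟩
  have hwalk : ∀ s t : ↥B, (G.induce B).Walk s t → s = t ∨ G.Adj s.1 t.1 := by
    intro s t p
    induction p with
    | nil => exact Or.inl rfl
    | @cons s m t h _ ih =>
      have h' : G.Adj s.1 m.1 := h
      rcases ih with rfl | ih
      · exact Or.inr h'
      · by_cases hst : s = t
        · exact Or.inl hst
        · exact Or.inr (hcon s s.2 m m.2 t t.2 h' ih.symm fun h => hst (Subtype.ext h))
  rcases hwalk _ _ p with h | h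
  · exact absurd (congrArg Subtype.val h) huv
  · exact h

/-- `c` and `d` are non-adjacent twins of degree two whose neighbours `a`, `b` are adjacent. -/
structure IsDiamondTwin (G : SimpleGraph V) (a b c d : V) : Prop where
  ne : c ≠ d
  adj : G.Adj a b
  adj_left : ∀ x, G.Adj c x ↔ x = a ∨ x = b
  adj_right : ∀ x, G.Adj d x ↔ x = a ∨ x = b

end Separation

section LowerBounds

variable {V : Type*} [Fintype V] {G : SimpleGraph V}

lemma two_mul_card_common_le (hG : G.Connected) {c d : V} (hcd : c ≠ d) (hadj : ¬ G.Adj c d)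
    {N : Finset V} (hN : ∀ a ∈ N, G.Adj c a ∧ G.Adj a d) (hne : N.Nonempty) :
    2 * N.card ≤ excess G c d + 2 := by
  have hlt := hG.one_lt_dist_of_ne_of_not_adj hcd hadj
  have hdist : ∀ a ∈ N, G.dist a c = 1 ∧ G.dist a d = 1 := fun a ha =>
    ⟨dist_eq_one_iff_adj.2 (hN a ha).1.symm, dist_eq_one_iff_adj.2 (hN a ha).2⟩
  have htwo : G.dist d c = 2 := by
    obtain ⟨a, ha⟩ := hne
    have := hG.dist_triangle (u := d) (v := a) (w := c)
    rw [G.dist_comm (u := d) (v := a), (hdist a ha).1, (hdist a ha).2] at this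
    rw [G.dist_comm] at hlt
    omega
  have hS : N.image (fun a => (c, a)) ∪ N.image (fun a => (a, d)) ⊆ separatingEdges G c d := by
    intro e he
    rcases Finset.mem_union.1 he with h | h <;> obtain ⟨a, ha, rfl⟩ := Finset.mem_image.1 h
    · refine mem_separatingEdges.2 ⟨(hN a ha).1, ?_, ?_⟩ <;> simp [hdist a ha, hlt]
    · refine mem_separatingEdges.2 ⟨(hN a ha).2, ?_, ?_⟩ <;> simp [hdist a ha, htwo]
  have h := card_le_excess_add hG hS
  rw [Finset.card_union_of_disjoint, Finset.card_image_of_injective _ (Prod.mk_right_injective c),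
    Finset.card_image_of_injective _ (Prod.mk_left_injective d)] at h
  · have himg : (N.image (fun a => (c, a)) ∪ N.image (fun a => (a, d))).image
        (fun e => G.dist e.1 c) ⊆ {0, 1} := by
      intro k hk
      obtain ⟨e, he, rfl⟩ := Finset.mem_image.1 hk
      rcases Finset.mem_union.1 he with h | h <;> obtain ⟨a, ha, rfl⟩ := Finset.mem_image.1 h
      · simp
      · simp [hdist a ha]
    have := Finset.card_le_card himg
    have : ({0, 1} : Finset ℕ).card = 2 := rfl
    omega
  · rw [Finset.disjoint_left]
    intro e he he'
    obtain ⟨a, ha, rfl⟩ := Finset.mem_image.1 he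
    obtain ⟨a', ha', h⟩ := Finset.mem_image.1 he'
    simp only [Prod.mk.injEq] at h
    exact hadj (h.2 ▸ (hN a ha).1)

lemma two_le_excess (hG : G.Connected) {c d a b : V} (hcd : c ≠ d) (hadj : ¬ G.Adj c d)
    (hab : a ≠ b) (hca : G.Adj c a) (hcb : G.Adj c b) (had : G.Adj a d) (hbd : G.Adj b d) :
    2 ≤ excess G c d := by
  have := two_mul_card_common_le hG hcd hadj (N := {a, b}) (by simp_all) (by simp)
  rw [Finset.card_pair hab] at this
  omega

lemma three_le_excess (hG : G.Connected) {c d a b z : V} (hcd : c ≠ d) (hadj : ¬ G.Adj c d)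
    (hab : a ≠ b) (haz : a ≠ z) (hbz : b ≠ z) (hca : G.Adj c a) (hcb : G.Adj c b)
    (hcz : G.Adj c z) (had : G.Adj a d) (hbd : G.Adj b d) (hzd : G.Adj z d) :
    3 ≤ excess G c d := by
  have := two_mul_card_common_le hG hcd hadj (N := {a, b, z}) (by simp_all) (by simp)
  rw [Finset.card_eq_three.2 ⟨a, b, z, hab, haz, hbz, rfl⟩] at this
  omega

/-- A 4-cycle with the chord `ab` but without the chord `cd`, where `c` has a further neighbour. -/
lemma six_le_sum_excess_of_neighbor (hG : G.Connected) {a b c d x : V} (hcd : c ≠ d)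
    (hncd : ¬ G.Adj c d) (hab : a ≠ b) (hadjab : G.Adj a b) (hca : G.Adj c a)
    (hcb : G.Adj c b) (had : G.Adj a d) (hbd : G.Adj b d) (hcx : G.Adj c x) (hxa : x ≠ a) (hxb : x ≠ b) :
    6 ≤ ∑ p : V × V, excess G p.1 p.2 := by
  have hbase := two_le_excess hG hcd hncd hab hca hcb had hbd
  have hxd : x ≠ d := fun h => hncd (h ▸ hcx)
  by_cases hadj : G.Adj x d
  · have := three_le_excess hG hcd hncd hab hxa.symm hxb.symm hca hcb hcx had hbd hadj
    have := two_mul_excess_le G hcd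
    omega
  suffices h : ∃ y z, y ≠ z ∧ ¬ (c = y ∧ d = z) ∧ ¬ (c = z ∧ d = y) ∧ 1 ≤ excess G y z by
    obtain ⟨y, z, hyz, h1, h2, h3⟩ := h
    have := two_mul_excess_add_excess_le G hcd hyz h1 h2
    omega
  have hxc : x ≠ c := hcx.ne'
  have hxd' : ¬ (c = x ∧ d = d) := fun h => hxc h.1.symm
  have hdx' : ¬ (c = d ∧ d = x) := fun h => hcd h.1
  by_cases hxa' : G.Adj x a
  · by_cases hxb' : G.Adj x b
    · exact ⟨x, d, hxd, hxd', hdx', le_trans (by norm_num)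
        (two_le_excess hG hxd hadj hab hxa' hxb' had hbd)⟩
    · exact ⟨x, b, hxb, fun h => hxc h.1.symm, fun h => hxd h.2.symm, le_trans (by norm_num)
        (two_le_excess hG hxb hxb' hca.ne hcx.symm hxa' hcb hadjab)⟩
  by_cases hxb' : G.Adj x b
  · exact ⟨x, a, hxa, fun h => hxc h.1.symm, fun h => hxd h.2.symm, le_trans (by norm_num)
      (two_le_excess hG hxa hxa' hcb.ne hcx.symm hxb' hca hadjab.symm)⟩
  refine ⟨x, d, hxd, hxd', hdx', ?_⟩
  have h1 := dist_eq_one_iff_adj.2 hcx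
  have h2 := hG.one_lt_dist_of_ne_of_not_adj hxa.symm (fun h => hxa' h.symm)
  have h3 := hG.one_lt_dist_of_ne_of_not_adj hxb.symm (fun h => hxb' h.symm)
  have h4 := hG.one_lt_dist_of_ne_of_not_adj hcd hncd
  have h5 := dist_eq_one_iff_adj.2 had
  have h6 := dist_eq_one_iff_adj.2 hbd
  have hS : {(c, a), (c, b)} ⊆ separatingEdges G x d := by
    intro e he
    simp only [mem_insert, Finset.mem_singleton] at he
    rcases he with rfl | rfl
    · exact mem_separatingEdges.2 ⟨hca, by omega, by omega⟩
    · exact mem_separatingEdges.2 ⟨hcb, by omega, by omega⟩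
  have := card_le_excess_add hG hS
  rw [Finset.card_pair (by simp [hab]), Finset.image_insert, Finset.image_singleton,
    Finset.pair_eq_singleton, Finset.card_singleton] at this
  omega

/-- Two distinct geodesics between vertices at distance at least `3`. -/
lemma three_le_excess_of_two_parents (hG : G.Connected)
    (hC4 : ∀ c d a b, c ≠ d → ¬ G.Adj c d → G.Adj c a → G.Adj c b → G.Adj a d → G.Adj b d → a = b)
    {x y p q : V} {k : ℕ} (hxy : G.dist x y = k + 3) (hpq : p ≠ q) (hxp : G.Adj x p)
    (hxq : G.Adj x q) (hp : G.dist p y = k + 2) (hq : G.dist q y = k + 2) :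
    3 ≤ excess G x y := by
  obtain ⟨p₂, hpp, hp₂⟩ := exists_adj_dist_eq hG hp
  obtain ⟨q₂, hqq, hq₂⟩ := exists_adj_dist_eq hG hq
  obtain ⟨p₃, hppp, hp₃⟩ := exists_adj_dist_eq hG hp₂
  obtain ⟨q₃, hqqq, hq₃⟩ := exists_adj_dist_eq hG hq₂
  have hne : p₂ ≠ q₂ := by
    rintro rfl
    refine hpq (hC4 x p₂ p q ?_ ?_ hxp hxq hpp hqq)
    · rintro rfl
      omega
    · intro h
      have := dist_le_succ_of_adj hG h y
      omega
  have hge : ∀ z, k + 3 ≤ G.dist z x + G.dist z y := by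
    intro z
    have := hG.dist_triangle (u := x) (v := z) (w := y)
    rw [G.dist_comm (u := x) (v := z)] at this
    omega
  have hxx : G.dist x x = 0 := dist_self
  have hpx := dist_le_succ_of_adj hG hxp.symm x
  have hqx := dist_le_succ_of_adj hG hxq.symm x
  have hp₂x := dist_le_succ_of_adj hG hpp.symm x
  have hq₂x := dist_le_succ_of_adj hG hqq.symm x
  have e1 := hge p
  have e2 := hge q
  have e3 := hge p₂
  have e4 := hge q₂
  have e5 := hge p₃
  have e6 := hge q₃
  have hpx' : G.dist p x = 1 := by omega
  have hqx' : G.dist q x = 1 := by omega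
  have hp₂x' : G.dist p₂ x = 2 := by omega
  have hq₂x' : G.dist q₂ x = 2 := by omega
  have hS : {(x, p), (x, q), (p, p₂), (q, q₂), (p₂, p₃), (q₂, q₃)} ⊆ separatingEdges G x y := by
    intro e he
    simp only [mem_insert, Finset.mem_singleton] at he
    rcases he with rfl | rfl | rfl | rfl | rfl | rfl <;>
      exact mem_separatingEdges.2 ⟨by assumption, by omega, by omega⟩
  have h := card_le_excess_add hG hS
  have himg : ({(x, p), (x, q), (p, p₂), (q, q₂), (p₂, p₃), (q₂, q₃)} : Finset (V × V)).image
      (fun e => G.dist e.1 x) = {0, 1, 2} := by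
    simp [Finset.image_insert, hpx', hqx', hp₂x', hq₂x']
  have hxp' := hxp.ne
  have hxq' := hxq.ne
  have hxp₂ : x ≠ p₂ := by rintro rfl; omega
  have hxq₂ : x ≠ q₂ := by rintro rfl; omega
  have hpp₂ : p ≠ p₂ := hpp.ne
  have hqq₂ : q ≠ q₂ := hqq.ne
  have hpq₂ : p ≠ q₂ := by rintro rfl; omega
  have hqp₂ : q ≠ p₂ := by rintro rfl; omega
  have hcard : ({(x, p), (x, q), (p, p₂), (q, q₂), (p₂, p₃), (q₂, q₃)} : Finset (V × V)).card
      = 6 := by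
    simp [Finset.card_insert_of_notMem, hpq, hne, hxp', hxq', hxp₂, hxq₂, hpp₂, hqq₂, hpq₂, hqp₂]
  rw [himg, hcard] at h
  have : ({0, 1, 2} : Finset ℕ).card = 3 := rfl
  omega

/-- An edge `pq` equidistant from `y` whose ends have distinct neighbours towards `y`. -/
lemma one_le_excess (hG : G.Connected)
    (hU : ∀ x y p q, G.Adj x p → G.Adj x q → G.dist p y + 1 = G.dist x y →
      G.dist q y + 1 = G.dist x y → p = q)
    {y p q p₁ q₁ : V} (hpq : G.Adj p q) (hd : G.dist p y = G.dist q y) (hp : G.Adj p p₁)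
    (hq : G.Adj q q₁) (hp₁ : G.dist p₁ y + 1 = G.dist p y) (hq₁ : G.dist q₁ y + 1 = G.dist q y)
    (hne : p₁ ≠ q₁) : 1 ≤ excess G y p := by
  have h0 : G.dist p p = 0 := dist_self
  have h1 := dist_eq_one_iff_adj.2 hp.symm
  have h2 := dist_eq_one_iff_adj.2 hpq.symm
  have h3 : 1 < G.dist q₁ p := by
    refine hG.one_lt_dist_of_ne_of_not_adj ?_ fun h => hne (hU p y _ _ hp h.symm hp₁ (by omega))
    rintro rfl
    omega
  have hS : {(p₁, p), (q₁, q)} ⊆ separatingEdges G y p := by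
    intro e he
    simp only [mem_insert, Finset.mem_singleton] at he
    rcases he with rfl | rfl
    · exact mem_separatingEdges.2 ⟨hp.symm, by omega, by omega⟩
    · exact mem_separatingEdges.2 ⟨hq.symm, by omega, by omega⟩
  have := card_le_excess_add hG hS
  have e : G.dist q₁ y = G.dist p₁ y := by omega
  rw [Finset.card_pair (by simp [hne]), Finset.image_insert, Finset.image_singleton, e,
    Finset.pair_eq_singleton, Finset.card_singleton] at this
  omega

/-- An odd isometric cycle of length at least `5`. -/
lemma six_le_sum_excess_of_level_edge (hG : G.Connected)
    (hU : ∀ x y p q, G.Adj x p → G.Adj x q → G.dist p y + 1 = G.dist x y →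
      G.dist q y + 1 = G.dist x y → p = q)
    (hO : ∃ r y p q p₁ q₁, G.Adj p q ∧ G.dist p y = r ∧ G.dist q y = r ∧ G.Adj p p₁ ∧
      G.Adj q q₁ ∧ G.dist p₁ y + 1 = r ∧ G.dist q₁ y + 1 = r ∧ p₁ ≠ q₁) :
    6 ≤ ∑ p : V × V, excess G p.1 p.2 := by
  obtain ⟨y, p, q, p₁, q₁, hpq, hpy, hqy, hpp, hqq, hp₁, hq₁, hne⟩ := Nat.find_spec hO
  have hmin := fun m => Nat.find_min hO (m := m)
  set r := Nat.find hO
  have hr : 2 ≤ r := by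
    by_contra hlt
    have h1 : p₁ = y := hG.dist_eq_zero_iff.1 (by omega)
    have h2 : q₁ = y := hG.dist_eq_zero_iff.1 (by omega)
    exact hne (h1.trans h2.symm)
  obtain ⟨w, hyw, hwq⟩ := exists_adj_dist_eq hG
    (show G.dist y q = (r - 1) + 1 by rw [G.dist_comm]; omega)
  rw [G.dist_comm] at hwq
  have hstep : ∀ z, G.dist z w ≤ G.dist z y + 1 ∧ G.dist z y ≤ G.dist z w + 1 := by
    intro z
    have h1 := dist_le_succ_of_adj hG hyw z
    have h2 := dist_le_succ_of_adj hG hyw.symm z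
    rw [G.dist_comm (u := y), G.dist_comm (u := w)] at h1 h2
    exact ⟨h2, h1⟩
  have hpw : G.dist p w = r := by
    have h1 := dist_le_succ_of_adj hG hpq w
    have h2 := hstep p
    by_contra hcon
    have h3 : G.dist p w = r - 1 := by omega
    obtain ⟨a, hpa, ha⟩ := exists_adj_dist_eq hG (show G.dist p w = (r - 2) + 1 by omega)
    obtain ⟨b, hqb, hb⟩ := exists_adj_dist_eq hG (show G.dist q w = (r - 2) + 1 by omega)
    refine hmin (r - 1) (by omega) ⟨w, p, q, a, b, hpq, h3, hwq, hpa, hqb, by omega, by omega, ?_⟩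
    rintro rfl
    have h4 := hstep a
    have h5 := dist_le_succ_of_adj hG hpa y
    exact hne ((hU p y _ _ hpp hpa (by omega) (by omega)).trans
      (hU q y _ _ hqb hqq (by omega) (by omega)))
  have hp₁w : G.dist p₁ w = r := by
    have h1 := dist_le_succ_of_adj hG hpp w
    have h2 := hstep p₁
    by_contra hcon
    have := hU p w _ _ hpp hpq (by omega) (by omega)
    subst this
    omega
  obtain ⟨z, hp₁z, hz⟩ := exists_adj_dist_eq hG (show G.dist p₁ w = (r - 1) + 1 by omega)
  have hqz : q ≠ z := by
    rintro rfl
    exact hne (hU q y _ _ hp₁z.symm hqq (by omega) (by omega))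
  have e1 := one_le_excess hG hU hpq (hpy.trans hqy.symm) hpp hqq (by omega) (by omega) hne
  have e2 := one_le_excess hG hU hpq.symm (hqy.trans hpy.symm) hqq hpp (by omega) (by omega) hne.symm
  have e3 := one_le_excess hG hU hpp (hpw.trans hp₁w.symm) hpq hp₁z (by omega) (by omega) hqz
  have hne0 : ∀ {s t : V}, G.dist s t = r → t ≠ s := by
    rintro s t h rfl
    simp only [SimpleGraph.dist_self] at h
    omega
  have := two_mul_excess_add_excess_add_excess_le G (hne0 hpy) (hne0 hqy) hpq.ne hyw.ne'
    (hne0 hpw)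
  omega

theorem six_le_sum_excess_or_isDiamondTwin (hG : G.Connected) {B : Set V} (hB : IsBlock G B)
    (hne : ¬ (∀ u ∈ B, ∀ v ∈ B, u ≠ v → G.Adj u v)) :
    6 ≤ ∑ p : V × V, excess G p.1 p.2 ∨
      4 ≤ ∑ p : V × V, excess G p.1 p.2 ∧ ∃ a b c d, IsDiamondTwin G a b c d := by
  by_contra! hcon
  obtain ⟨hlt, htwin⟩ := hcon
  have hC4 : ∀ c d a b, c ≠ d → ¬ G.Adj c d → G.Adj c a → G.Adj c b → G.Adj a d → G.Adj b d →
      a = b := by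
    intro c d a b hcd hncd hca hcb had hbd
    by_contra hab
    have hex := two_le_excess hG hcd hncd hab hca hcb had hbd
    have hadj : G.Adj a b := by
      by_contra hnab
      have := two_le_excess hG hab hnab hcd hca.symm had hcb hbd.symm
      have := two_mul_excess_add_excess_le G hcd hab (fun h => hca.ne h.1) (fun h => hcb.ne h.1)
      omega
    refine htwin (by have := two_mul_excess_le G hcd; omega) a b c d ⟨hcd, hadj, fun x => ⟨?_, ?_⟩,
      fun x => ⟨?_, ?_⟩⟩
    · intro hx
      by_contra! h
      have := six_le_sum_excess_of_neighbor hG hcd hncd hab hadj hca hcb had hbd hx h.1 h.2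
      omega
    · rintro (rfl | rfl) <;> assumption
    · intro hx
      by_contra! h
      have := six_le_sum_excess_of_neighbor hG hcd.symm (fun h => hncd h.symm) hab hadj had.symm
        hbd.symm hca.symm hcb.symm hx h.1 h.2
      omega
    · rintro (rfl | rfl)
      exacts [had.symm, hbd.symm]
  have hU : ∀ x y p q, G.Adj x p → G.Adj x q → G.dist p y + 1 = G.dist x y →
      G.dist q y + 1 = G.dist x y → p = q := by
    intro x y p q hxp hxq hp hq
    rcases (by omega : G.dist x y = 1 ∨ G.dist x y = 2 ∨ 3 ≤ G.dist x y) with h | h | h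
    · rw [hG.dist_eq_zero_iff.1 (show G.dist p y = 0 by omega),
        hG.dist_eq_zero_iff.1 (show G.dist q y = 0 by omega)]
    · refine hC4 x y p q ?_ (fun h' => ?_) hxp hxq (dist_eq_one_iff_adj.1 (by omega))
        (dist_eq_one_iff_adj.1 (by omega))
      · rintro rfl
        simp at h
      · have := dist_eq_one_iff_adj.2 h'
        omega
    · by_contra hpq
      have := three_le_excess_of_two_parents hG hC4 (y := y) (k := G.dist x y - 3) (by omega) hpq hxp hxq
        (by omega) (by omega)
      have hxy : x ≠ y := by
        rintro rfl
        simp at h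
      have := two_mul_excess_le G hxy
      omega
  obtain ⟨c, hc, b, hb, d, hd, hcb, hdb, hcd, hncd⟩ := exists_induced_path_of_not_clique hB.1 hne
  refine not_reachable_of_unique_parents hG hU ?_ hcb hdb hcd hncd ⟨hc, hcb.ne⟩ ⟨hd, hdb.ne⟩
    (hB.2.1 b hb _ _)
  intro y p q k hpq hp hq
  obtain ⟨p₁, hpp, hp₁⟩ := exists_adj_dist_eq hG hp
  obtain ⟨q₁, hqq, hq₁⟩ := exists_adj_dist_eq hG hq
  by_cases h : p₁ = q₁
  · exact ⟨p₁, hpp, h ▸ hqq, hp₁⟩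
  · have := six_le_sum_excess_of_level_edge hG hU ⟨k + 2, y, p, q, p₁, q₁, hpq, hp, hq, hpp, hqq,
      by omega, by omega, h⟩
    omega

end LowerBounds

section Levels

variable {α : Type*} {S : Finset α} {f : α → ℕ}

lemma range_succ_subset_image (hf : ∀ x ∈ S, ∀ k, f x = k + 1 → ∃ y ∈ S, f y = k) {x : α}
    (hx : x ∈ S) : range (f x + 1) ⊆ S.image f := by
  have hdown : ∀ j ≤ f x, ∃ y ∈ S, f y + j = f x := by
    intro j
    induction j with
    | zero => exact fun _ => ⟨x, hx, rfl⟩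
    | succ j ih =>
      intro hj
      obtain ⟨y, hy, h⟩ := ih (by omega)
      obtain ⟨z, hz, h'⟩ := hf y hy (f y - 1) (by omega)
      exact ⟨z, hz, by omega⟩
  intro i hi
  rw [Finset.mem_range] at hi
  obtain ⟨y, hy, h⟩ := hdown (f x - i) (by omega)
  exact Finset.mem_image.2 ⟨y, hy, by omega⟩

lemma level_lt_card (hf : ∀ x ∈ S, ∀ k, f x = k + 1 → ∃ y ∈ S, f y = k) {x : α}
    (hx : x ∈ S) : f x < S.card := by
  have h := Finset.card_le_card (range_succ_subset_image hf hx)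
  rw [Finset.card_range] at h
  exact h.trans Finset.card_image_le

lemma two_mul_sum_level_le (hf : ∀ x ∈ S, ∀ k, f x = k + 1 → ∃ y ∈ S, f y = k) :
    2 * ∑ x ∈ S, f x + S.card ≤ S.card ^ 2 ∧
      (2 * ∑ x ∈ S, f x + S.card = S.card ^ 2 → Set.InjOn f S) := by
  induction hm : S.card generalizing S with
  | zero => simp [Finset.card_eq_zero.1 hm]
  | succ m ih =>
    obtain ⟨x, hx, hmax⟩ := Finset.exists_max_image S f (Finset.card_pos.1 (by omega))
    have hcard : (S.erase x).card = m := by rw [Finset.card_erase_of_mem hx]; omega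
    have hS' : ∀ y ∈ S.erase x, ∀ k, f y = k + 1 → ∃ z ∈ S.erase x, f z = k := by
      intro y hy k hk
      obtain ⟨z, hz, h⟩ := hf y (Finset.mem_of_mem_erase hy) k hk
      refine ⟨z, Finset.mem_erase.2 ⟨?_, hz⟩, h⟩
      rintro rfl
      have := hmax y (Finset.mem_of_mem_erase hy)
      omega
    have h1 := (ih hS' hcard).1
    have h2 := level_lt_card hf hx
    rw [← Finset.add_sum_erase S f hx]
    refine ⟨by nlinarith, fun heq => ?_⟩
    have h3 : f x + 1 = S.card := by
      by_contra hne
      have : f x + 1 ≤ m := by omega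
      nlinarith
    rw [← Finset.card_image_iff]
    refine le_antisymm Finset.card_image_le ?_
    have := Finset.card_le_card (range_succ_subset_image hf hx)
    rwa [Finset.card_range, h3] at this

end Levels

section Wiener

variable {V : Type*} {G : SimpleGraph V}

lemma sum_insert_sum_insert_dist (G : SimpleGraph V) {S : Finset V} {v : V} (hv : v ∉ S) :
    ∑ x ∈ insert v S, ∑ y ∈ insert v S, G.dist x y =
      2 * ∑ y ∈ S, G.dist v y + ∑ x ∈ S, ∑ y ∈ S, G.dist x y := by
  rw [Finset.sum_insert hv, Finset.sum_insert hv, SimpleGraph.dist_self]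
  simp only [Finset.sum_insert hv, Finset.sum_add_distrib, G.dist_comm (v := v)]
  ring

lemma dist_le_dist_induce {S : Set V} (hS : (G.induce S).Connected) (x y : S) :
    G.dist x y ≤ (G.induce S).dist x y := by
  obtain ⟨p, hp⟩ := hS.exists_walk_length_eq_dist x y
  rw [← hp, ← Walk.length_map (Embedding.induce S).toHom p]
  exact dist_le _

lemma sum_dist_le_sum_dist_induce {T : Set V} [Fintype T] (hT : (G.induce T).Connected)
    {S : Finset V} (hS : ∀ x, x ∈ S ↔ x ∈ T) :
    ∑ x ∈ S, ∑ y ∈ S, G.dist x y ≤ ∑ x, ∑ y, (G.induce T).dist x y := by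
  have hsub : ∀ g : V → ℕ, ∑ x ∈ S, g x = ∑ x : T, g x := fun g => Finset.sum_subtype _ hS g
  rw [hsub]
  refine Finset.sum_le_sum fun x _ => ?_
  rw [hsub]
  exact Finset.sum_le_sum fun y _ => dist_le_dist_induce hT x y

lemma two_mul_sum_dist_le [Fintype V] (hG : G.Connected) (v : V) :
    2 * ∑ y, G.dist v y + Fintype.card V ≤ Fintype.card V ^ 2 := by
  refine (two_mul_sum_level_le (S := univ) (f := fun y => G.dist v y) ?_).1
  intro x _ k hk
  obtain ⟨z, _, hz⟩ := exists_adj_dist_eq hG (show G.dist x v = k + 1 by rw [← hk, G.dist_comm])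
  exact ⟨z, mem_univ z, by rw [← hz, G.dist_comm]⟩

lemma three_mul_sum_dist_le [Fintype V] (hG : G.Connected) :
    3 * ∑ x, ∑ y, G.dist x y + Fintype.card V ≤ Fintype.card V ^ 3 := by
  induction hm : Fintype.card V generalizing V with
  | zero =>
    have := Fintype.card_eq_zero_iff.1 hm
    simp
  | succ m ih =>
    rcases Nat.eq_zero_or_pos m with rfl | hpos
    · obtain ⟨v, hv⟩ := Fintype.card_eq_one_iff.1 hm
      simp [hv]
    have : Nontrivial V := Fintype.one_lt_card_iff_nontrivial.1 (by omega)
    obtain ⟨v, hv⟩ := hG.exists_connected_induce_compl_singleton_of_finite_nontrivial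
    have h1 := ih hv (by rw [Fintype.card_compl_set, hm]; simp)
    have h2 := two_mul_sum_dist_le hG v
    have h3 := sum_dist_le_sum_dist_induce hv (S := univ.erase v) (by simp)
    have h4 := sum_insert_sum_insert_dist G (Finset.notMem_erase v univ)
    have h5 := Finset.add_sum_erase univ (G.dist v) (mem_univ v)
    rw [Finset.insert_erase (mem_univ v)] at h4
    rw [SimpleGraph.dist_self] at h5
    rw [hm] at h2
    rw [h4]
    nlinarith

lemma three_mul_sum_dist_le_of_induce {S : Finset V}
    (hS : (G.induce (S : Set V)).Connected) :
    3 * ∑ x ∈ S, ∑ y ∈ S, G.dist x y + S.card ≤ S.card ^ 3 := by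
  have h := three_mul_sum_dist_le hS
  have h3 := sum_dist_le_sum_dist_induce hS (S := S) (by simp)
  have hc : Fintype.card ↥(S : Set V) = S.card := by simp
  rw [hc] at h
  omega

lemma connected_induce_of_descent {S : Set V} {r : V} (hr : r ∈ S) (f : V → ℕ)
    (h : ∀ x ∈ S, x ≠ r → ∃ y ∈ S, G.Adj x y ∧ f y < f x) : (G.induce S).Connected := by
  have hreach : ∀ k, ∀ x : S, f x = k → (G.induce S).Reachable x ⟨r, hr⟩ := by
    intro k
    induction k using Nat.strong_induction_on with
    | _ k ih =>
      intro x hx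
      by_cases hxr : x.1 = r
      · rw [show x = ⟨r, hr⟩ from Subtype.ext hxr]
      · obtain ⟨y, hy, hadj, hlt⟩ := h x x.2 hxr
        have hadj' : (G.induce S).Adj x ⟨y, hy⟩ := hadj
        exact hadj'.reachable.trans (ih (f y) (hx ▸ hlt) ⟨y, hy⟩ rfl)
  have : Nonempty S := ⟨⟨r, hr⟩⟩
  exact ⟨fun x y => (hreach _ x rfl).trans (hreach _ y rfl).symm⟩

end Wiener

namespace IsDiamondTwin

variable {V : Type*} {G : SimpleGraph V} {a b c d : V}

lemma swap_twins (h : IsDiamondTwin G a b c d) : IsDiamondTwin G a b d c :=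
  ⟨h.ne.symm, h.adj, h.adj_right, h.adj_left⟩

lemma swap_hubs (h : IsDiamondTwin G a b c d) : IsDiamondTwin G b a c d :=
  ⟨h.ne, h.adj.symm, fun x => (h.adj_left x).trans or_comm, fun x => (h.adj_right x).trans or_comm⟩

lemma adj_ca (h : IsDiamondTwin G a b c d) : G.Adj c a := (h.adj_left a).2 (Or.inl rfl)

lemma adj_cb (h : IsDiamondTwin G a b c d) : G.Adj c b := (h.adj_left b).2 (Or.inr rfl)

lemma adj_da (h : IsDiamondTwin G a b c d) : G.Adj d a := h.swap_twins.adj_ca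

lemma adj_db (h : IsDiamondTwin G a b c d) : G.Adj d b := h.swap_twins.adj_cb

lemma dist_cd (hG : G.Connected) (h : IsDiamondTwin G a b c d) : G.dist c d = 2 := by
  have h1 := hG.one_lt_dist_of_ne_of_not_adj h.ne fun hcd => by
    rcases (h.adj_left d).1 hcd with rfl | rfl
    exacts [h.adj_da.ne rfl, h.adj_db.ne rfl]
  have h2 := dist_le_succ_of_adj hG h.adj_ca d
  have h3 := dist_eq_one_iff_adj.2 h.adj_da.symm
  omega

lemma two_le_dist (hG : G.Connected) (h : IsDiamondTwin G a b c d) {x : V} (ha : x ≠ a)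
    (hb : x ≠ b) (hc : x ≠ c) : 2 ≤ G.dist c x :=
  hG.one_lt_dist_of_ne_of_not_adj hc.symm fun hadj => ((h.adj_left x).1 hadj).elim ha hb

lemma exists_parent (hG : G.Connected) (h : IsDiamondTwin G a b c d) {x : V} {k : ℕ}
    (hx : G.dist c x = k + 2) :
    ∃ y, G.Adj x y ∧ G.dist c y = k + 1 ∧ y ≠ c ∧ y ≠ d := by
  obtain ⟨y, hadj, hy⟩ := exists_adj_dist_eq hG
    (show G.dist x c = (k + 1) + 1 by rw [G.dist_comm]; exact hx)
  rw [G.dist_comm] at hy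
  refine ⟨y, hadj, hy, ?_, ?_⟩
  · rintro rfl
    simp at hy
  · rintro rfl
    rcases (h.adj_right x).1 hadj.symm with rfl | rfl
    · rw [dist_eq_one_iff_adj.2 h.adj_ca] at hx
      omega
    · rw [dist_eq_one_iff_adj.2 h.adj_cb] at hx
      omega

variable [Fintype V]

/-- The vertices outside the diamond together with `a`. -/
def tail (b c d : V) : Finset V := univ.filter fun x => x ≠ b ∧ x ≠ c ∧ x ≠ d

lemma mem_tail {x : V} : x ∈ tail b c d ↔ x ≠ b ∧ x ≠ c ∧ x ≠ d := by simp [tail]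

lemma hub_mem_tail (h : IsDiamondTwin G a b c d) : a ∈ tail b c d :=
  mem_tail.2 ⟨h.adj.ne, h.adj_ca.ne', h.adj_da.ne'⟩

lemma univ_eq_insert_tail (b c d : V) :
    (univ : Finset V) = insert c (insert d (insert b (tail b c d))) := by
  ext x
  simp only [mem_univ, mem_insert, mem_tail, true_iff]
  tauto

lemma card_eq (h : IsDiamondTwin G a b c d) : Fintype.card V = (tail b c d).card + 3 := by
  rw [← Finset.card_univ, univ_eq_insert_tail b c d, Finset.card_insert_of_notMem, Finset.card_insert_of_notMem,
    Finset.card_insert_of_notMem]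
  all_goals simp [mem_tail, h.ne, h.adj_cb.ne, h.adj_db.ne]

lemma one_le_dist_of_mem_tail (hG : G.Connected) {x : V} (hx : x ∈ tail b c d) :
    1 ≤ G.dist c x :=
  hG.pos_dist_of_ne (mem_tail.1 hx).2.1.symm

lemma tail_levels (hG : G.Connected) (h : IsDiamondTwin G a b c d) :
    ∀ x ∈ tail b c d, ∀ k, G.dist c x - 1 = k + 1 → ∃ y ∈ tail b c d, G.dist c y - 1 = k := by
  intro x _ k hk
  obtain ⟨y, _, hy, hyc, hyd⟩ := h.exists_parent hG (show G.dist c x = k + 2 by omega)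
  by_cases hyb : y = b
  · refine ⟨a, h.hub_mem_tail, ?_⟩
    rw [dist_eq_one_iff_adj.2 h.adj_ca]
    rw [hyb, dist_eq_one_iff_adj.2 h.adj_cb] at hy
    omega
  · exact ⟨y, mem_tail.2 ⟨hyb, hyc, hyd⟩, by omega⟩

lemma dist_lt_card (hG : G.Connected) (h : IsDiamondTwin G a b c d) {x : V}
    (hx : x ∈ tail b c d) : G.dist c x + 3 ≤ Fintype.card V := by
  have := level_lt_card (h.tail_levels hG) hx
  have := h.card_eq
  have := one_le_dist_of_mem_tail hG hx
  omega

lemma sum_tail_dist (hG : G.Connected) :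
    ∑ x ∈ tail b c d, G.dist c x = ∑ x ∈ tail b c d, (G.dist c x - 1) + (tail b c d).card := by
  rw [Finset.card_eq_sum_ones, ← Finset.sum_add_distrib]
  refine Finset.sum_congr rfl fun x hx => ?_
  have := one_le_dist_of_mem_tail hG hx
  omega

lemma tail_comm : tail b c d = tail b d c := by
  ext x
  simp only [mem_tail]
  tauto

lemma sum_dist_eq (hG : G.Connected) (h : IsDiamondTwin G a b c d) :
    ∑ x, ∑ y, G.dist x y = 8 + 2 * ∑ x ∈ tail b c d, G.dist c x +
      2 * ∑ x ∈ tail b c d, G.dist d x +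
      ∑ x ∈ insert b (tail b c d), ∑ y ∈ insert b (tail b c d), G.dist x y := by
  have hb : b ∉ tail b c d := by simp [mem_tail]
  have hd : d ∉ insert b (tail b c d) := by simp [mem_tail, h.adj_db.ne]
  have hc : c ∉ insert d (insert b (tail b c d)) := by simp [mem_tail, h.adj_cb.ne, h.ne]
  rw [univ_eq_insert_tail b c d, sum_insert_sum_insert_dist G hc, sum_insert_sum_insert_dist G hd,
    Finset.sum_insert hd, Finset.sum_insert hb, Finset.sum_insert hb, h.dist_cd hG,
    dist_eq_one_iff_adj.2 h.adj_cb, dist_eq_one_iff_adj.2 h.adj_db]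
  ring

lemma connected_insert_tail (hG : G.Connected) (h : IsDiamondTwin G a b c d) :
    (G.induce (insert b (tail b c d) : Finset V)).Connected := by
  refine connected_induce_of_descent (r := a) (by simp [h.hub_mem_tail]) (fun x => G.dist x a) ?_
  intro x hx hxa
  have hpos := hG.pos_dist_of_ne hxa
  have hxcd : x ≠ c ∧ x ≠ d := by
    rcases Finset.mem_insert.1 (Finset.mem_coe.1 hx) with rfl | hx
    · exact ⟨h.adj_cb.ne', h.adj_db.ne'⟩
    · exact (mem_tail.1 hx).2
  by_cases hxb : x = b
  · refine ⟨a, by simp [h.hub_mem_tail], hxb ▸ h.adj.symm, by simpa using hpos⟩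
  obtain ⟨y, hadj, hy⟩ := exists_adj_dist_eq hG (show G.dist x a = (G.dist x a - 1) + 1 by omega)
  refine ⟨y, ?_, hadj, by omega⟩
  simp only [coe_insert, Set.mem_insert_iff, Finset.mem_coe, mem_tail]
  by_cases hyb : y = b
  · exact Or.inl hyb
  · refine Or.inr ⟨hyb, ?_, ?_⟩
    · rintro rfl
      exact ((h.adj_left x).1 hadj.symm).elim hxa hxb
    · rintro rfl
      exact ((h.adj_right x).1 hadj.symm).elim hxa hxb

lemma three_mul_sum_dist_le (hG : G.Connected) (h : IsDiamondTwin G a b c d) :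
    3 * ∑ x, ∑ y, G.dist x y + 19 * Fintype.card V ≤ Fintype.card V ^ 3 + 54 := by
  have h1 := (two_mul_sum_level_le (h.tail_levels hG)).1
  have h2 := (two_mul_sum_level_le (h.swap_twins.tail_levels hG)).1
  have h3 := sum_tail_dist (b := b) (c := c) (d := d) hG
  have h4 := sum_tail_dist (b := b) (c := d) (d := c) hG
  have h5 := three_mul_sum_dist_le_of_induce (h.connected_insert_tail hG)
  rw [tail_comm] at h2 h4
  rw [Finset.card_insert_of_notMem (by simp [mem_tail])] at h5
  rw [h.sum_dist_eq hG, h.card_eq]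
  nlinarith

/-- Equality in `three_mul_sum_dist_le` forces distinct distances from the twins. -/
lemma eq_of_dist_eq (hG : G.Connected) (h : IsDiamondTwin G a b c d)
    (heq : 3 * ∑ x, ∑ y, G.dist x y + 19 * Fintype.card V = Fintype.card V ^ 3 + 54)
    {x y : V} (hx : x ≠ d) (hy : y ≠ d) (hle : 2 ≤ G.dist c x) (hxy : G.dist c x = G.dist c y) :
    x = y := by
  obtain ⟨h1, h1'⟩ := two_mul_sum_level_le (h.tail_levels hG)
  have h2 := (two_mul_sum_level_le (h.swap_twins.tail_levels hG)).1
  have h3 := sum_tail_dist (b := b) (c := c) (d := d) hG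
  have h4 := sum_tail_dist (b := b) (c := d) (d := c) hG
  have h5 := three_mul_sum_dist_le_of_induce (h.connected_insert_tail hG)
  rw [tail_comm] at h2 h4
  rw [Finset.card_insert_of_notMem (by simp [mem_tail])] at h5
  rw [h.sum_dist_eq hG, h.card_eq] at heq
  have hinj := h1' (by nlinarith)
  have hmem : ∀ z, z ≠ d → 2 ≤ G.dist c z → z ∈ tail b c d := by
    refine fun z hz hlt => mem_tail.2 ⟨?_, ?_, hz⟩
    · rintro rfl
      rw [dist_eq_one_iff_adj.2 h.adj_cb] at hlt
      omega
    · rintro rfl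
      simp at hlt
  exact hinj (hmem x hx hle) (hmem y hy (hxy ▸ hle)) (by simp [hxy])

/-- Equality in `three_mul_sum_dist_le` forces the rest of the graph to meet only one hub. -/
lemma not_adj_both (hG : G.Connected) (h : IsDiamondTwin G a b c d)
    (heq : 3 * ∑ x, ∑ y, G.dist x y + 19 * Fintype.card V = Fintype.card V ^ 3 + 54)
    {x : V} (hc : x ≠ c) (hd : x ≠ d) (hxa : G.Adj x a) : ¬ G.Adj x b := by
  intro hxb
  have hx2 : G.dist c x = 2 := by
    have h1 := h.two_le_dist hG hxa.ne hxb.ne hc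
    have h2 := dist_le_succ_of_adj hG h.adj_ca x
    rw [dist_eq_one_iff_adj.2 hxa.symm] at h2
    omega
  have hxT : x ∈ tail b c d := mem_tail.2 ⟨hxb.ne, hc, hd⟩
  have hb : b ∉ tail b c d := by simp [mem_tail]
  have hcard : 2 ≤ (tail b c d).card :=
    Finset.one_lt_card.2 ⟨a, h.hub_mem_tail, x, hxT, hxa.ne'⟩
  have hconn : (G.induce (tail b c d : Finset V)).Connected := by
    refine connected_induce_of_descent (r := a) (by simpa using h.hub_mem_tail)
      (fun z => G.dist c z) ?_
    intro z hz hza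
    obtain ⟨hzb, hzc, hzd⟩ := mem_tail.1 hz
    have hz2 := h.two_le_dist hG hza hzb hzc
    obtain ⟨y, hadj, hy, hyc, hyd⟩ := h.exists_parent hG
      (show G.dist c z = (G.dist c z - 2) + 2 by omega)
    by_cases hyb : y = b
    · rw [hyb, dist_eq_one_iff_adj.2 h.adj_cb] at hy
      have hzx : z = x := h.eq_of_dist_eq hG heq hzd hd hz2 (by omega)
      refine ⟨a, by simpa using h.hub_mem_tail, hzx ▸ hxa, ?_⟩
      simp only [dist_eq_one_iff_adj.2 h.adj_ca]
      omega
    · exact ⟨y, by simp [mem_tail, hyb, hyc, hyd], hadj, by omega⟩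
  have hle : ∀ z ∈ tail b c d, G.dist b z ≤ (G.dist c z - 1) + if z = a then 1 else 0 := by
    intro z hz
    obtain ⟨hzb, hzc, hzd⟩ := mem_tail.1 hz
    by_cases hza : z = a
    · subst hza
      simp [dist_eq_one_iff_adj.2 h.adj.symm]
    simp only [hza, if_false, add_zero]
    have key : ∀ k, ∀ z, z ≠ d → G.dist c z = k + 2 → G.dist b z ≤ k + 1 := by
      intro k
      induction k with
      | zero =>
        intro z hzd hz
        have : z = x := h.eq_of_dist_eq hG heq hzd hd (by omega) (by omega)
        subst this
        exact (dist_eq_one_iff_adj.2 hxb.symm).le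
      | succ k ih =>
        intro z hzd hz
        obtain ⟨y, hadj, hy, hyc, hyd⟩ := h.exists_parent hG hz
        have h1 := ih y hyd hy
        have h2 := dist_le_succ_of_adj hG hadj b
        rw [G.dist_comm, G.dist_comm (u := y)] at h2
        omega
    have := h.two_le_dist hG hza hzb hzc
    have := key (G.dist c z - 2) z hzd (by omega)
    omega
  have hsum := Finset.sum_le_sum hle
  rw [Finset.sum_add_distrib, Finset.sum_ite_eq' (tail b c d) a, if_pos h.hub_mem_tail] at hsum
  have h1 := (two_mul_sum_level_le (h.tail_levels hG)).1
  have h2 := (two_mul_sum_level_le (h.swap_twins.tail_levels hG)).1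
  have h3 := sum_tail_dist (b := b) (c := c) (d := d) hG
  have h4 := sum_tail_dist (b := b) (c := d) (d := c) hG
  have h5 := three_mul_sum_dist_le_of_induce hconn
  rw [tail_comm] at h2 h4
  rw [h.sum_dist_eq hG, h.card_eq, sum_insert_sum_insert_dist G hb] at heq
  nlinarith

end IsDiamondTwin

lemma Bn1_adj {n : ℕ} {i j : Fin n} : (Bn1 n).Adj i j ↔ i.val ≠ j.val ∧
    (((i.val + 1 = j.val ∧ j.val ≤ n - 3) ∨
      (i.val = n - 4 ∧ j.val = n - 2) ∨ (i.val = n - 4 ∧ j.val = n - 1) ∨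
      (i.val = n - 3 ∧ j.val = n - 2) ∨ (i.val = n - 3 ∧ j.val = n - 1)) ∨
    ((j.val + 1 = i.val ∧ i.val ≤ n - 3) ∨
      (j.val = n - 4 ∧ i.val = n - 2) ∨ (j.val = n - 4 ∧ i.val = n - 1) ∨
      (j.val = n - 3 ∧ i.val = n - 2) ∨ (j.val = n - 3 ∧ i.val = n - 1))) := by
  simp only [Bn1, SimpleGraph.fromRel_adj, ne_eq, Fin.ext_iff]

namespace IsDiamondTwin

variable {V : Type*} [Fintype V] {G : SimpleGraph V} {a b c d : V}

set_option maxHeartbeats 1000000 in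
lemma nonempty_iso_Bn1 (hG : G.Connected) (h : IsDiamondTwin G a b c d) {n : ℕ}
    (hn : Fintype.card V = n)
    (hinj : ∀ x y, x ≠ d → y ≠ d → 2 ≤ G.dist c x → G.dist c x = G.dist c y → x = y)
    (hb : ∀ x, G.Adj b x → x = a ∨ x = c ∨ x = d) : Nonempty (G ≃g Bn1 n) := by
  let g : V → ℕ := fun x =>
    if x = b then n - 3 else if x = c then n - 2 else if x = d then n - 1 else n - 3 - G.dist c x
  have hbc := h.adj_cb.ne'
  have hbd := h.adj_db.ne'
  have hcd := h.ne
  have hac := h.adj_ca.ne'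
  have had := h.adj_da.ne'
  have hab := h.adj.ne
  have hn4 : 4 ≤ n := by
    have := h.card_eq
    have := Finset.card_pos.2 ⟨a, h.hub_mem_tail⟩
    omega
  have hgb : g b = n - 3 := by simp [g]
  have hgc : g c = n - 2 := by simp [g, hbc.symm]
  have hgd : g d = n - 1 := by simp [g, hbd.symm, hcd.symm]
  have hgT : ∀ x ∈ tail b c d, g x + G.dist c x = n - 3 ∧ 1 ≤ G.dist c x := by
    intro x hx
    obtain ⟨hxb, hxc, hxd⟩ := mem_tail.1 hx
    have h1 := h.dist_lt_card hG hx
    have h2 := one_le_dist_of_mem_tail hG hx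
    simp only [g, hxb, hxc, hxd, if_false]
    omega
  have hca := dist_eq_one_iff_adj.2 h.adj_ca
  have hdist : ∀ x ∈ tail b c d, x ≠ a → 2 ≤ G.dist c x := fun x hx hxa =>
    h.two_le_dist hG hxa (mem_tail.1 hx).1 (mem_tail.1 hx).2.1
  have hcases : ∀ x, x = b ∨ x = c ∨ x = d ∨ x ∈ tail b c d := by
    intro x
    rw [mem_tail]
    tauto
  have hinjT : ∀ x ∈ tail b c d, ∀ y ∈ tail b c d, G.dist c x = G.dist c y → x = y := by
    intro x hx y hy hxy
    by_cases hxa : x = a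
    · by_contra hne
      have := hdist y hy fun hya => hne (hxa.trans hya.symm)
      rw [hxa] at hxy
      omega
    · exact hinj x y (mem_tail.1 hx).2.2 (mem_tail.1 hy).2.2 (hdist x hx hxa) hxy
  have hlt : ∀ x, g x < n := by
    intro x
    rcases hcases x with rfl | rfl | rfl | hx
    · omega
    · omega
    · omega
    · have := hgT x hx
      omega
  have hginj : ∀ x y, g x = g y → x = y := by
    intro x y hxy
    rcases hcases x with rfl | rfl | rfl | hx <;> rcases hcases y with rfl | rfl | rfl | hy <;>
      first
      | rfl
      | (exfalso; omega)
      | (have := hgT _ hx; have := hgT _ hy; exact hinjT _ hx _ hy (by omega))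
      | (exfalso; have := hgT _ hx; omega)
      | (exfalso; have := hgT _ hy; omega)
  have hga : g a = n - 4 := by
    have := hgT a h.hub_mem_tail
    omega
  have hval : ∀ x y, x = y ↔ g x = g y := fun x y => ⟨fun h => h ▸ rfl, hginj x y⟩
  have hbadj : ∀ x, G.Adj b x ↔ x = a ∨ x = c ∨ x = d := by
    refine fun x => ⟨hb x, ?_⟩
    rintro (rfl | rfl | rfl)
    exacts [h.adj.symm, h.adj_cb.symm, h.adj_db.symm]
  have hchild : ∀ x ∈ tail b c d, ∀ y ∈ tail b c d, G.dist c y = G.dist c x + 1 → G.Adj x y := by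
    intro x hx y hy hxy
    have h1 := one_le_dist_of_mem_tail hG hx
    obtain ⟨z, hadj, hz, hzc, hzd⟩ := h.exists_parent hG
      (show G.dist c y = (G.dist c x - 1) + 2 by omega)
    have hzb : z ≠ b := by
      rintro rfl
      rcases hb y hadj.symm with rfl | h' | h'
      · omega
      · exact (mem_tail.1 hy).2.1 h'
      · exact (mem_tail.1 hy).2.2 h'
    have := hinjT z (mem_tail.2 ⟨hzb, hzc, hzd⟩) x hx (by omega)
    exact this ▸ hadj.symm
  have htail : ∀ x ∈ tail b c d, ∀ y ∈ tail b c d,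
      (G.Adj x y ↔ g x + 1 = g y ∨ g y + 1 = g x) := by
    intro x hx y hy
    have h1 := hgT x hx
    have h2 := hgT y hy
    constructor
    · intro hadj
      have h3 := dist_le_succ_of_adj hG hadj c
      have h4 := dist_le_succ_of_adj hG hadj.symm c
      rw [G.dist_comm, G.dist_comm (u := y)] at h3
      rw [G.dist_comm, G.dist_comm (u := x)] at h4
      have h5 : G.dist c x ≠ G.dist c y := fun h => hadj.ne (hinjT x hx y hy h)
      omega
    · rintro (h' | h')
      · exact (hchild y hy x hx (by omega)).symm
      · exact hchild x hx y hy (by omega)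
  let φ : V → Fin n := fun x => ⟨g x, hlt x⟩
  have hφ : Function.Injective φ := fun x y hxy => hginj x y (congrArg Fin.val hxy)
  have hbij : Function.Bijective φ :=
    (Fintype.bijective_iff_injective_and_card φ).2 ⟨hφ, by simp [hn]⟩
  have hspecial : ∀ x y, x = b ∨ x = c ∨ x = d →
      ((Bn1 n).Adj (φ x) (φ y) ↔ G.Adj x y) := by
    intro x y hx
    have hy : g y = n - 3 ∨ g y = n - 2 ∨ g y = n - 1 ∨ g y ≤ n - 4 := by
      have := hlt y
      omega
    rw [Bn1_adj]
    simp only [φ]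
    rcases hx with rfl | rfl | rfl
    · rw [hbadj, hval, hval y c, hval y d]
      omega
    · rw [h.adj_left, hval, hval y b]
      omega
    · rw [h.adj_right, hval, hval y b]
      omega
  refine ⟨⟨Equiv.ofBijective φ hbij, ?_⟩⟩
  intro x y
  simp only [Equiv.ofBijective_apply]
  by_cases hx : x = b ∨ x = c ∨ x = d
  · exact hspecial x y hx
  by_cases hy : y = b ∨ y = c ∨ y = d
  · rw [SimpleGraph.adj_comm, hspecial y x hy, SimpleGraph.adj_comm]
  have hxT : x ∈ tail b c d := mem_tail.2 (by tauto)
  have hyT : y ∈ tail b c d := mem_tail.2 (by tauto)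
  rw [htail x hxT y hyT, Bn1_adj]
  have := hgT x hxT
  have := hgT y hyT
  simp only [φ]
  omega

lemma nonempty_iso_Bn1_of_sum_dist_eq (hG : G.Connected) (h : IsDiamondTwin G a b c d)
    (heq : 3 * ∑ x, ∑ y, G.dist x y + 19 * Fintype.card V = Fintype.card V ^ 3 + 54)
    {n : ℕ} (hn : Fintype.card V = n) : Nonempty (G ≃g Bn1 n) := by
  have hinj := fun x y hx hy hle hxy => h.eq_of_dist_eq hG heq (x := x) (y := y) hx hy hle hxy
  by_cases hb : ∀ x, G.Adj b x → x = a ∨ x = c ∨ x = d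
  · exact h.nonempty_iso_Bn1 hG hn hinj hb
  push Not at hb
  obtain ⟨x, hbx, hxa, hxc, hxd⟩ := hb
  refine h.swap_hubs.nonempty_iso_Bn1 hG hn hinj fun y hay => ?_
  by_contra! hy
  have hdist : ∀ z, z ≠ a → z ≠ b → z ≠ c → (G.Adj a z ∨ G.Adj b z) → G.dist c z = 2 := by
    intro z hza hzb hzc hadj
    have h1 := h.two_le_dist hG hza hzb hzc
    rcases hadj with hadj | hadj
    · have h2 := dist_le_succ_of_adj hG h.adj_ca z
      rw [dist_eq_one_iff_adj.2 hadj] at h2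
      omega
    · have h2 := dist_le_succ_of_adj hG h.adj_cb z
      rw [dist_eq_one_iff_adj.2 hadj] at h2
      omega
  have hx2 := hdist x hxa hbx.ne' hxc (Or.inr hbx)
  have hy2 := hdist y hay.ne' hy.1 hy.2.1 (Or.inl hay)
  have hxy : x = y := hinj x y hxd hy.2.2 hx2.ge (hx2.trans hy2.symm)
  exact h.not_adj_both hG heq hxc hxd (hxy ▸ hay.symm) hbx.symm

end IsDiamondTwin

lemma exists_walk_of_descent {V : Type*} {G : SimpleGraph V} {D : V → V → ℕ}
    (hzero : ∀ x z, D x z = 0 → x = z)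
    (hstep : ∀ x z m, D x z = m + 1 → ∃ y, G.Adj x y ∧ D y z = m) (x z : V) :
    ∃ p : G.Walk x z, p.length = D x z := by
  induction h : D x z generalizing x with
  | zero =>
    obtain rfl := hzero x z h
    exact ⟨.nil, rfl⟩
  | succ m ih =>
    obtain ⟨y, hadj, hy⟩ := hstep x z m h
    obtain ⟨p, hp⟩ := ih y hy
    exact ⟨.cons hadj p, by simp [hp]⟩

lemma dist_eq_of_descent {V : Type*} {G : SimpleGraph V} {D : V → V → ℕ}
    (hzero : ∀ x z, D x z = 0 ↔ x = z) (hlip : ∀ x y z, G.Adj x y → D x z ≤ D y z + 1)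
    (hstep : ∀ x z m, D x z = m + 1 → ∃ y, G.Adj x y ∧ D y z = m) (x z : V) :
    G.dist x z = D x z := by
  obtain ⟨p, hp⟩ := exists_walk_of_descent (fun x z => (hzero x z).1) hstep x z
  refine le_antisymm (hp ▸ dist_le p) ?_
  obtain ⟨q, hq⟩ := p.reachable.exists_walk_length_eq_dist
  rw [← hq]
  clear hp hq p
  induction q with
  | nil => simp [(hzero _ _).2]
  | cons hadj q ih =>
    rw [Walk.length_cons]
    exact (hlip _ _ _ hadj).trans (by omega)

/-- The distance function of `Bn1 (k + 4)`. -/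
def Bn1Dist (k i j : ℕ) : ℕ :=
  if i = j then 0
  else if k + 1 ≤ i ∧ k + 1 ≤ j then (if i = k + 1 ∨ j = k + 1 then 1 else 2)
  else if i ≤ k ∧ j ≤ k then (i - j) + (j - i)
  else if i ≤ k then k + 1 - i else k + 1 - j

lemma Bn1_adj_add_four {k : ℕ} {i j : Fin (k + 4)} : (Bn1 (k + 4)).Adj i j ↔
    ((i.val + 1 = j.val ∧ j.val ≤ k + 1) ∨
      (i.val = k ∧ j.val = k + 2) ∨ (i.val = k ∧ j.val = k + 3) ∨
      (i.val = k + 1 ∧ j.val = k + 2) ∨ (i.val = k + 1 ∧ j.val = k + 3)) ∨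
    ((j.val + 1 = i.val ∧ i.val ≤ k + 1) ∨
      (j.val = k ∧ i.val = k + 2) ∨ (j.val = k ∧ i.val = k + 3) ∨
      (j.val = k + 1 ∧ i.val = k + 2) ∨ (j.val = k + 1 ∧ i.val = k + 3)) := by
  rw [Bn1_adj]
  exact and_iff_right_of_imp fun h => by omega

lemma Bn1_adj_of_succ {k : ℕ} {i j : Fin (k + 4)} (h : i.val + 1 = j.val) (hj : j.val ≤ k + 1) :
    (Bn1 (k + 4)).Adj i j :=
  Bn1_adj_add_four.2 (.inl (.inl ⟨h, hj⟩))

lemma Bn1_adj_of_hub {k : ℕ} {i j : Fin (k + 4)} (h : i.val = k ∨ i.val = k + 1)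
    (hj : i.val < j.val) : (Bn1 (k + 4)).Adj i j := by
  have := j.2
  by_cases hs : i.val + 1 = j.val ∧ j.val ≤ k + 1
  · exact Bn1_adj_of_succ hs.1 hs.2
  · exact Bn1_adj_add_four.2 (.inl (by omega))

lemma Bn1Dist_self {k i : ℕ} : Bn1Dist k i i = 0 := by simp [Bn1Dist]

lemma Bn1Dist_comm {k i j : ℕ} : Bn1Dist k i j = Bn1Dist k j i := by
  unfold Bn1Dist
  split_ifs <;> omega

lemma Bn1Dist_of_le {k i j : ℕ} (hi : i ≤ k) (hj : j ≤ k) :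
    Bn1Dist k i j = (i - j) + (j - i) := by
  unfold Bn1Dist
  split_ifs <;> omega

lemma Bn1Dist_of_le_of_lt {k i j : ℕ} (hi : i ≤ k) (hj : k < j) : Bn1Dist k i j = k + 1 - i := by
  unfold Bn1Dist
  split_ifs <;> omega

lemma Bn1Dist_of_lt_of_le {k i j : ℕ} (hi : k < i) (hj : j ≤ k) : Bn1Dist k i j = k + 1 - j := by
  rw [Bn1Dist_comm, Bn1Dist_of_le_of_lt hj hi]

lemma Bn1Dist_of_eq_succ {k i j : ℕ} (hi : i = k + 1) (hj : k + 1 < j) : Bn1Dist k i j = 1 := by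
  unfold Bn1Dist
  split_ifs <;> omega

lemma Bn1Dist_of_lt {k i j : ℕ} (hi : k + 1 < i) (hj : k + 1 < j) (h : i ≠ j) :
    Bn1Dist k i j = 2 := by
  unfold Bn1Dist
  split_ifs <;> omega

lemma Bn1Dist_eq_zero_iff {k i j : ℕ} : Bn1Dist k i j = 0 ↔ i = j := by
  constructor
  · intro h
    unfold Bn1Dist at h
    split_ifs at h <;> omega
  · rintro rfl
    exact Bn1Dist_self

lemma Bn1Dist_le_succ {k : ℕ} {i j : Fin (k + 4)} (h : (Bn1 (k + 4)).Adj i j) (l : Fin (k + 4)) :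
    Bn1Dist k i l ≤ Bn1Dist k j l + 1 := by
  rw [Bn1_adj_add_four] at h
  have := i.2
  have := j.2
  have := l.2
  unfold Bn1Dist
  split_ifs <;> omega

lemma exists_adj_Bn1Dist {k : ℕ} (i l : Fin (k + 4)) (m : ℕ) (h : Bn1Dist k i l = m + 1) :
    ∃ j, (Bn1 (k + 4)).Adj i j ∧ Bn1Dist k j l = m := by
  have hi := i.2
  have hl := l.2
  have hne : i.val ≠ l.val := fun hil => by
    rw [Bn1Dist_eq_zero_iff.2 hil] at h
    omega
  rcases le_or_gt i.val k with hik | hik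
  · rcases lt_or_gt_of_ne hne with hlt | hlt
    · rcases le_or_gt l.val k with hlk | hlk
      · refine ⟨⟨i + 1, by omega⟩, Bn1_adj_of_succ rfl (Nat.succ_le_succ hik), ?_⟩
        rw [Bn1Dist_of_le hik hlk] at h
        dsimp only
        rw [Bn1Dist_of_le (by omega) hlk]
        omega
      rw [Bn1Dist_of_le_of_lt hik hlk] at h
      by_cases hik' : i.val = k
      · exact ⟨l, Bn1_adj_of_hub (.inl hik') hlt, Bn1Dist_self.trans (by omega)⟩
      · refine ⟨⟨i + 1, by omega⟩, Bn1_adj_of_succ rfl (Nat.succ_le_succ hik), ?_⟩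
        dsimp only
        rw [Bn1Dist_of_le_of_lt (by omega) hlk]
        omega
    · refine ⟨⟨i - 1, by omega⟩, (Bn1_adj_of_succ (Nat.sub_add_cancel (by omega)) (by omega)).symm, ?_⟩
      rw [Bn1Dist_of_le hik (by omega)] at h
      dsimp only
      rw [Bn1Dist_of_le (by omega) (by omega)]
      omega
  · have hk : (Bn1 (k + 4)).Adj i ⟨k, by omega⟩ := (Bn1_adj_of_hub (.inl rfl) hik).symm
    rcases le_or_gt l.val k with hlk | hlk
    · refine ⟨_, hk, ?_⟩
      rw [Bn1Dist_of_lt_of_le hik hlk] at h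
      dsimp only
      rw [Bn1Dist_of_le le_rfl hlk]
      omega
    by_cases hi1 : i.val = k + 1
    · rw [Bn1Dist_of_eq_succ hi1 (by omega)] at h
      exact ⟨l, Bn1_adj_of_hub (.inr hi1) (by omega), Bn1Dist_self.trans (by omega)⟩
    by_cases hl1 : l.val = k + 1
    · rw [Bn1Dist_comm, Bn1Dist_of_eq_succ hl1 (by omega)] at h
      exact ⟨l, (Bn1_adj_of_hub (.inr hl1) (by omega)).symm, Bn1Dist_self.trans (by omega)⟩
    · rw [Bn1Dist_of_lt (by omega) (by omega) hne] at h
      refine ⟨_, hk, ?_⟩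
      dsimp only
      rw [Bn1Dist_of_le_of_lt le_rfl hlk]
      omega

lemma Bn1_dist {k : ℕ} (i j : Fin (k + 4)) : (Bn1 (k + 4)).dist i j = Bn1Dist k i j :=
  dist_eq_of_descent (D := fun i j : Fin (k + 4) => Bn1Dist k i j)
    (fun _ _ => Bn1Dist_eq_zero_iff.trans Fin.ext_iff.symm)
    (fun _ _ l h => Bn1Dist_le_succ h l) exists_adj_Bn1Dist i j

lemma sum_range_sub_mul_two (m : ℕ) : (∑ j ∈ range m, (m - j)) * 2 = m * (m + 1) := by
  induction m with
  | zero => simp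
  | succ m ih =>
    rw [Finset.sum_range_succ']
    simp only [Nat.add_sub_add_right, Nat.sub_zero, add_mul, ih]
    ring

lemma sum_range_sum_range_sub (m : ℕ) :
    3 * ∑ i ∈ range m, ∑ j ∈ range m, ((i - j) + (j - i)) + m = m ^ 3 := by
  induction m with
  | zero => simp
  | succ m ih =>
    have h1 : ∑ j ∈ range m, ((m - j) + (j - m)) = ∑ j ∈ range m, (m - j) :=
      Finset.sum_congr rfl fun j hj => by
        have := Finset.mem_range.1 hj
        omega
    have h2 : ∑ j ∈ range m, ((j - m) + (m - j)) = ∑ j ∈ range m, (m - j) :=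
      Finset.sum_congr rfl fun j hj => by
        have := Finset.mem_range.1 hj
        omega
    have h3 := sum_range_sub_mul_two m
    have h4 : ∑ i ∈ range (m + 1), ∑ j ∈ range (m + 1), ((i - j) + (j - i)) =
        ∑ i ∈ range m, ∑ j ∈ range m, ((i - j) + (j - i)) + (∑ j ∈ range m, (m - j)) * 2 := by
      rw [Finset.sum_range_succ, Finset.sum_range_succ]
      simp only [Finset.sum_range_succ _ m]
      rw [Finset.sum_add_distrib, h1, h2]
      omega
    rw [h4, h3]
    linarith [show (m + 1) ^ 3 = m ^ 3 + 3 * (m * (m + 1)) + 1 by ring]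

lemma three_mul_sum_Bn1_dist (k : ℕ) :
    3 * ∑ x, ∑ y, (Bn1 (k + 4)).dist x y + 19 * (k + 4) = (k + 4) ^ 3 + 54 := by
  simp only [Bn1_dist]
  have hrow : ∀ i, ∑ y : Fin (k + 4), Bn1Dist k i y = ∑ j ∈ range (k + 1), Bn1Dist k i j +
      Bn1Dist k i (k + 1) + Bn1Dist k i (k + 2) + Bn1Dist k i (k + 3) := fun i => by
    rw [Fin.sum_univ_eq_sum_range (Bn1Dist k i), Finset.sum_range_succ, Finset.sum_range_succ,
      Finset.sum_range_succ]
  have hcol : ∀ i, k < i → ∑ j ∈ range (k + 1), Bn1Dist k i j = ∑ j ∈ range (k + 1), (k + 1 - j) :=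
    fun i hi => Finset.sum_congr rfl fun j hj =>
      Bn1Dist_of_lt_of_le hi (Nat.lt_succ_iff.1 (Finset.mem_range.1 hj))
  have hpath : ∑ i ∈ range (k + 1), (∑ j ∈ range (k + 1), Bn1Dist k i j +
      Bn1Dist k i (k + 1) + Bn1Dist k i (k + 2) + Bn1Dist k i (k + 3)) =
      ∑ i ∈ range (k + 1), ∑ j ∈ range (k + 1), ((i - j) + (j - i)) +
        (∑ j ∈ range (k + 1), (k + 1 - j)) * 3 := by
    rw [Finset.sum_mul, ← Finset.sum_add_distrib]
    refine Finset.sum_congr rfl fun i hi => ?_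
    have hik := Nat.lt_succ_iff.1 (Finset.mem_range.1 hi)
    rw [Bn1Dist_of_le_of_lt hik (by omega), Bn1Dist_of_le_of_lt hik (by omega),
      Bn1Dist_of_le_of_lt hik (by omega), Finset.sum_congr rfl fun j hj =>
        Bn1Dist_of_le hik (Nat.lt_succ_iff.1 (Finset.mem_range.1 hj))]
    ring
  have hA := sum_range_sum_range_sub (k + 1)
  have hs := sum_range_sub_mul_two (k + 1)
  rw [Fin.sum_univ_eq_sum_range (fun i => ∑ y : Fin (k + 4), Bn1Dist k i y)]
  simp only [hrow]
  rw [Finset.sum_range_succ, Finset.sum_range_succ, Finset.sum_range_succ, hpath,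
    hcol _ (by omega), hcol _ (by omega), hcol _ (by omega)]
  have h12 : Bn1Dist k (k + 1) (k + 2) = 1 := Bn1Dist_of_eq_succ rfl (by omega)
  have h13 : Bn1Dist k (k + 1) (k + 3) = 1 := Bn1Dist_of_eq_succ rfl (by omega)
  have h23 : Bn1Dist k (k + 2) (k + 3) = 2 := Bn1Dist_of_lt (by omega) (by omega) (by omega)
  rw [Bn1Dist_comm (i := k + 2) (j := k + 1), Bn1Dist_comm (i := k + 3) (j := k + 1),
    Bn1Dist_comm (i := k + 3) (j := k + 2), h12, h13, h23]
  simp only [Bn1Dist_self]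
  linarith [show (k + 4) ^ 3 + 54 =
    (k + 1) ^ 3 + 9 * ((k + 1) * (k + 1 + 1)) + 19 * (k + 4) + 24 - (k + 1) by
      apply Nat.eq_sub_of_add_eq
      ring]

/-- The number of vertices of `Bn1 (k + 4)` that are closer to `i` than to `j`. -/
def Bn1Closer (k i j : ℕ) : ℕ :=
  #{w ∈ range (k + 4) | Bn1Dist k i w < Bn1Dist k j w}

lemma nCloser_Bn1 {k : ℕ} (i j : Fin (k + 4)) :
    nCloser (Bn1 (k + 4)) i j = Bn1Closer k i j := by
  simp only [nCloser, Bn1Closer, Finset.card_filter, Bn1_dist]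
  exact Fin.sum_univ_eq_sum_range (fun w => if Bn1Dist k i w < Bn1Dist k j w then 1 else 0) _

lemma Bn1Closer_succ {k i : ℕ} (hi : i < k) : Bn1Closer k i (i + 1) = i + 1 := by
  have : {w ∈ range (k + 4) | Bn1Dist k i w < Bn1Dist k (i + 1) w} = range (i + 1) := by
    ext w
    rw [Finset.mem_filter, Finset.mem_range, Finset.mem_range]
    unfold Bn1Dist
    split_ifs <;> omega
  rw [Bn1Closer, this, card_range]

lemma Bn1Closer_succ_left {k i : ℕ} (hi : i < k) : Bn1Closer k (i + 1) i = k + 3 - i := by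
  have : {w ∈ range (k + 4) | Bn1Dist k (i + 1) w < Bn1Dist k i w} = Ico (i + 1) (k + 4) := by
    ext w
    rw [Finset.mem_filter, Finset.mem_range, Finset.mem_Ico]
    unfold Bn1Dist
    split_ifs <;> omega
  rw [Bn1Closer, this, Nat.card_Ico]
  omega

lemma Bn1Closer_hubs {k : ℕ} : Bn1Closer k k (k + 1) = k + 1 := by
  have : {w ∈ range (k + 4) | Bn1Dist k k w < Bn1Dist k (k + 1) w} = range (k + 1) := by
    ext w
    rw [Finset.mem_filter, Finset.mem_range, Finset.mem_range]
    unfold Bn1Dist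
    split_ifs <;> omega
  rw [Bn1Closer, this, card_range]

lemma Bn1Closer_of_hub {k i j : ℕ} (hi : i = k ∨ i = k + 1) (hj : k < j) (hij : i < j)
    (hj' : j < k + 4) : Bn1Closer k j i = 1 := by
  have : {w ∈ range (k + 4) | Bn1Dist k j w < Bn1Dist k i w} = {j} := by
    ext w
    rw [Finset.mem_filter, Finset.mem_range, Finset.mem_singleton]
    unfold Bn1Dist
    split_ifs <;> omega
  rw [Bn1Closer, this, card_singleton]

lemma Bn1Closer_twin {k j : ℕ} (hj : j = k + 2 ∨ j = k + 3) : Bn1Closer k k j = k + 2 := by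
  have : {w ∈ range (k + 4) | Bn1Dist k k w < Bn1Dist k j w} =
      insert (2 * k + 5 - j) (range (k + 1)) := by
    ext w
    rw [Finset.mem_filter, Finset.mem_range, Finset.mem_insert, Finset.mem_range]
    unfold Bn1Dist
    split_ifs <;> omega
  rw [Bn1Closer, this, card_insert_of_notMem, card_range]
  rw [Finset.mem_range]
  omega

lemma Bn1Closer_succ_twin {k j : ℕ} (hj : j = k + 2 ∨ j = k + 3) :
    Bn1Closer k (k + 1) j = 2 := by
  have : {w ∈ range (k + 4) | Bn1Dist k (k + 1) w < Bn1Dist k j w} =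
      {k + 1, 2 * k + 5 - j} := by
    ext w
    rw [Finset.mem_filter, Finset.mem_range, Finset.mem_insert, Finset.mem_singleton]
    unfold Bn1Dist
    split_ifs <;> omega
  rw [Bn1Closer, this, card_pair]
  omega

/-- The defining relation of `Bn1 (k + 4)`, orienting every edge upwards. -/
def Bn1Rel (k i j : ℕ) : Prop :=
  (i + 1 = j ∧ j ≤ k + 1) ∨ (i = k ∧ j = k + 2) ∨ (i = k ∧ j = k + 3) ∨
    (i = k + 1 ∧ j = k + 2) ∨ (i = k + 1 ∧ j = k + 3)

lemma Bn1Rel.lt {k i j : ℕ} (h : Bn1Rel k i j) : i < j := by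
  unfold Bn1Rel at h
  omega

/-- The contribution of the pair `i < j` to the Szeged index of `Bn1 (k + 4)`. -/
def Bn1Weight (k i j : ℕ) : ℚ :=
  if Bn1Rel k i j then (Bn1Closer k i j : ℚ) * Bn1Closer k j i else 0

lemma szeged_Bn1_eq_sum (k : ℕ) :
    szeged (Bn1 (k + 4)) = ∑ i ∈ range (k + 4), ∑ j ∈ range (k + 4), Bn1Weight k i j := by
  have hterm : ∀ i j : Fin (k + 4), (if (Bn1 (k + 4)).Adj i j then
      (nCloser (Bn1 (k + 4)) i j : ℚ) * (nCloser (Bn1 (k + 4)) j i : ℚ) else 0) =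
      Bn1Weight k i j + Bn1Weight k j i := by
    intro i j
    rw [nCloser_Bn1, nCloser_Bn1]
    have hiff : (Bn1 (k + 4)).Adj i j ↔ Bn1Rel k i j ∨ Bn1Rel k j i := Bn1_adj_add_four
    by_cases h1 : Bn1Rel k i j
    · have h2 : ¬ Bn1Rel k j i := fun h2 => lt_asymm h1.lt h2.lt
      simp [Bn1Weight, hiff, h1, h2]
    · by_cases h2 : Bn1Rel k j i
      · simp [Bn1Weight, hiff, h1, h2, mul_comm]
      · simp [Bn1Weight, hiff, h1, h2]
  have hsum : ∑ i : Fin (k + 4), ∑ j : Fin (k + 4), Bn1Weight k i j =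
      ∑ i ∈ range (k + 4), ∑ j ∈ range (k + 4), Bn1Weight k i j := by
    rw [← Fin.sum_univ_eq_sum_range (fun i => ∑ j ∈ range (k + 4), Bn1Weight k i j)]
    exact Finset.sum_congr rfl fun i _ => Fin.sum_univ_eq_sum_range (Bn1Weight k i) _
  simp only [szeged, hterm, Finset.sum_add_distrib]
  rw [Finset.sum_comm (f := fun i j : Fin (k + 4) => Bn1Weight k j i), hsum]
  ring

lemma sum_Bn1Weight_of_lt {k i : ℕ} (hi : i < k) :
    ∑ j ∈ range (k + 4), Bn1Weight k i j = (i + 1) * (k + 3 - i) := by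
  rw [Finset.sum_eq_single (i + 1)]
  · have hrel : Bn1Rel k i (i + 1) := Or.inl ⟨rfl, by omega⟩
    rw [Bn1Weight, if_pos hrel, Bn1Closer_succ hi, Bn1Closer_succ_left hi,
      Nat.cast_sub (by omega)]
    push_cast
    ring
  · intro j _ hj
    refine if_neg fun h => ?_
    unfold Bn1Rel at h
    omega
  · intro h
    rw [Finset.mem_range] at h
    omega

lemma sum_Bn1Weight_of_le {k i : ℕ} (hi : k ≤ i) :
    ∑ j ∈ range (k + 4), Bn1Weight k i j =
      Bn1Weight k i (k + 1) + Bn1Weight k i (k + 2) + Bn1Weight k i (k + 3) := by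
  rw [Finset.sum_range_succ, Finset.sum_range_succ, Finset.sum_range_succ, Finset.sum_eq_zero,
    zero_add]
  intro j hj
  rw [Finset.mem_range] at hj
  exact if_neg fun h => by have := h.lt; omega

lemma Bn1Weight_self {k i : ℕ} : Bn1Weight k i i = 0 :=
  if_neg fun hr => hr.lt.false

lemma Bn1Weight_of_lt {k i j : ℕ} (h : k + 1 < i) : Bn1Weight k i j = 0 :=
  if_neg fun hr => by
    unfold Bn1Rel at hr
    omega

lemma Bn1Weight_of_hub {k i j : ℕ} (hi : i = k ∨ i = k + 1) (hj : k < j) (hij : i < j)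
    (hj' : j < k + 4) : Bn1Weight k i j = Bn1Closer k i j := by
  have hrel : Bn1Rel k i j := by
    unfold Bn1Rel
    omega
  rw [Bn1Weight, if_pos hrel, Bn1Closer_of_hub hi hj hij hj', Nat.cast_one, mul_one]

lemma six_mul_sum_range_mul_sub (c : ℚ) (m : ℕ) :
    6 * ∑ i ∈ range m, ((i : ℚ) + 1) * (c - i) = m * (m + 1) * (3 * c - 2 * (m - 1)) := by
  induction m with
  | zero => simp
  | succ m ih =>
    rw [Finset.sum_range_succ, mul_add, ih]
    push_cast
    ring

lemma szeged_Bn1 (k : ℕ) :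
    6 * szeged (Bn1 (k + 4)) = ((k : ℚ) + 4) ^ 3 - 19 * (k + 4) + 66 := by
  rw [szeged_Bn1_eq_sum, Finset.sum_range_succ, Finset.sum_range_succ, Finset.sum_range_succ,
    Finset.sum_range_succ, Finset.sum_congr rfl fun i hi =>
      sum_Bn1Weight_of_lt (Finset.mem_range.1 hi),
    Finset.sum_eq_zero fun j _ => Bn1Weight_of_lt (i := k + 2) (j := j) (by omega),
    Finset.sum_eq_zero fun j _ => Bn1Weight_of_lt (i := k + 3) (j := j) (by omega),
    sum_Bn1Weight_of_le le_rfl, sum_Bn1Weight_of_le (Nat.le_succ k),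
    Bn1Weight_self, Bn1Weight_of_hub (.inl rfl) (by omega) (by omega) (by omega),
    Bn1Weight_of_hub (.inl rfl) (by omega) (by omega) (by omega),
    Bn1Weight_of_hub (.inl rfl) (by omega) (by omega) (by omega),
    Bn1Weight_of_hub (.inr rfl) (by omega) (by omega) (by omega),
    Bn1Weight_of_hub (.inr rfl) (by omega) (by omega) (by omega),
    Bn1Closer_hubs, Bn1Closer_twin (.inl rfl), Bn1Closer_twin (.inr rfl),
    Bn1Closer_succ_twin (.inl rfl), Bn1Closer_succ_twin (.inr rfl)]
  have h := six_mul_sum_range_mul_sub ((k : ℚ) + 3) k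
  push_cast
  linear_combination h

lemma two_mul_wienerIndex {V : Type*} [Fintype V] (G : SimpleGraph V) :
    2 * wienerIndex G = ((∑ x, ∑ y, G.dist x y : ℕ) : ℚ) := by
  rw [wienerIndex]
  push_cast
  ring

lemma six_mul_wienerIndex_Bn1 (k : ℕ) :
    6 * wienerIndex (Bn1 (k + 4)) = ((k : ℚ) + 4) ^ 3 - 19 * (k + 4) + 54 := by
  have h1 := two_mul_wienerIndex (Bn1 (k + 4))
  have h2 : ((3 * ∑ x, ∑ y, (Bn1 (k + 4)).dist x y + 19 * (k + 4) : ℕ) : ℚ) =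
    (((k + 4) ^ 3 + 54 : ℕ) : ℚ) := congrArg _ (three_mul_sum_Bn1_dist k)
  rw [Nat.cast_add, Nat.cast_mul, ← h1] at h2
  push_cast at h2
  linarith

section Iso

variable {V W : Type*} {G : SimpleGraph V} {H : SimpleGraph W}

lemma dist_iso_le (f : G ≃g H) (hG : G.Connected) (x y : V) : H.dist (f x) (f y) ≤ G.dist x y := by
  obtain ⟨p, hp⟩ := hG.exists_walk_length_eq_dist x y
  rw [← hp, ← p.length_map f.toHom]
  exact dist_le _

lemma dist_iso (f : G ≃g H) (hG : G.Connected) (x y : V) : H.dist (f x) (f y) = G.dist x y := by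
  refine le_antisymm (dist_iso_le f hG x y) ?_
  have := dist_iso_le f.symm (f.connected_iff.1 hG) (f x) (f y)
  rwa [f.symm_apply_apply, f.symm_apply_apply] at this

variable [Fintype V] [Fintype W]

lemma wienerIndex_iso (f : G ≃g H) (hG : G.Connected) : wienerIndex G = wienerIndex H := by
  simp only [wienerIndex]
  rw [← f.toEquiv.sum_comp]
  congr 1
  refine Finset.sum_congr rfl fun x _ => ?_
  rw [← f.toEquiv.sum_comp]
  exact Finset.sum_congr rfl fun y _ => by rw [← dist_iso f hG]; rfl

lemma nCloser_iso (f : G ≃g H) (hG : G.Connected) (x y : V) :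
    nCloser H (f x) (f y) = nCloser G x y := by
  simp only [nCloser, Finset.card_filter]
  rw [← f.toEquiv.sum_comp]
  refine Finset.sum_congr rfl fun z _ => ?_
  rw [← dist_iso f hG, ← dist_iso f hG]
  rfl

lemma szeged_iso (f : G ≃g H) (hG : G.Connected) : szeged G = szeged H := by
  simp only [szeged]
  rw [← f.toEquiv.sum_comp]
  congr 1
  refine Finset.sum_congr rfl fun x _ => ?_
  rw [← f.toEquiv.sum_comp]
  refine Finset.sum_congr rfl fun y _ => ?_
  rw [← nCloser_iso f hG, ← nCloser_iso f hG]
  exact if_congr f.map_adj_iff.symm rfl rfl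

end Iso

lemma wienerIndex_pos {V : Type*} [Fintype V] {G : SimpleGraph V} (hG : G.Connected)
    (hcard : 1 < Fintype.card V) : 0 < wienerIndex G := by
  obtain ⟨x, y, hxy⟩ := Fintype.one_lt_card_iff.1 hcard
  refine div_pos (Finset.sum_pos' (fun _ _ => Finset.sum_nonneg fun _ _ => Nat.cast_nonneg _)
    ⟨x, Finset.mem_univ x, Finset.sum_pos' (fun _ _ => Nat.cast_nonneg _)
      ⟨y, Finset.mem_univ y, ?_⟩⟩) two_pos
  exact_mod_cast hG.pos_dist_of_ne hxy

/-- For a connected graph `G` on `n ≥ 5` vertices with at least one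
non-complete block, `Sz(G)/W(G) ≥ 1 + 12/(n³ - 19n + 54)`, with equality iff
`G ≅ B_n^{(1)}`. -/
theorem szeged_div_wiener_lower_bound_of_noncomplete_block
    {V : Type*} [Fintype V] (G : SimpleGraph V) (n : ℕ)
    (hcard : Fintype.card V = n) (hn : 5 ≤ n) (hconn : G.Connected)
    (hblock : ∃ B : Set V, IsBlock G B ∧ ¬ (∀ u ∈ B, ∀ v ∈ B, u ≠ v → G.Adj u v)) :
    1 + 12 / ((n : ℚ) ^ 3 - 19 * n + 54) ≤ szeged G / wienerIndex G ∧
    (szeged G / wienerIndex G = 1 + 12 / ((n : ℚ) ^ 3 - 19 * n + 54) ↔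
      Nonempty (G ≃g Bn1 n)) := by
  obtain ⟨B, hB, hne⟩ := hblock
  have hW := wienerIndex_pos hconn (by omega)
  have hn' : (5 : ℚ) ≤ n := by exact_mod_cast hn
  set P : ℚ := (n : ℚ) ^ 3 - 19 * n + 54 with hP
  have hP0 : 0 < P := by nlinarith [mul_nonneg (sub_nonneg.2 hn') (sub_nonneg.2 hn')]
  obtain ⟨E, hE⟩ : ∃ E : ℕ, E = ∑ p : V × V, excess G p.1 p.2 := ⟨_, rfl⟩
  have hSz : szeged G = wienerIndex G + (E : ℚ) / 2 := by
    rw [szeged_eq_wienerIndex_add hconn, hE, Fintype.sum_prod_type]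
    push_cast
    rfl
  have hiso : Nonempty (G ≃g Bn1 n) → szeged G / wienerIndex G = 1 + 12 / P := by
    rintro ⟨f⟩
    obtain ⟨k, rfl⟩ : ∃ k, n = k + 4 := ⟨n - 4, by omega⟩
    have h1 := six_mul_wienerIndex_Bn1 k
    have h2 := szeged_Bn1 k
    rw [← wienerIndex_iso f hconn] at h1
    rw [← szeged_iso f hconn] at h2
    have h3 : P = 6 * wienerIndex G := by
      rw [h1, hP]
      push_cast
      rfl
    have h4 : szeged G = wienerIndex G + 2 := by linarith
    rw [h3, h4]
    field_simp
    ring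
  have hratio : szeged G / wienerIndex G = 1 + E / 2 / wienerIndex G := by
    rw [hSz, add_div, div_self hW.ne']
  rw [hratio] at hiso ⊢
  have hdist := two_mul_wienerIndex G
  rcases six_le_sum_excess_or_isDiamondTwin hconn hB hne with h6 | ⟨h4, a, b, c, d, h⟩
  · have hlt : 12 / P < E / 2 / wienerIndex G := by
      have hE6 : (6 : ℚ) ≤ E := by exact_mod_cast hE ▸ h6
      have hle : ((3 * ∑ x, ∑ y, G.dist x y + Fintype.card V : ℕ) : ℚ) ≤
        ((Fintype.card V ^ 3 : ℕ) : ℚ) := by exact_mod_cast three_mul_sum_dist_le hconn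
      rw [Nat.cast_add, Nat.cast_mul, ← hdist, hcard] at hle
      push_cast at hle
      rw [div_lt_div_iff₀ hP0 hW]
      have h3P : 12 * wienerIndex G < 3 * P := by
        nlinarith [mul_nonneg (sub_nonneg.2 hn') (sub_nonneg.2 hn')]
      nlinarith
    exact ⟨by linarith, fun heq => by linarith, hiso⟩
  · have hE4 : (4 : ℚ) ≤ E := by exact_mod_cast hE ▸ h4
    have hle := h.three_mul_sum_dist_le hconn
    have hle' : ((3 * ∑ x, ∑ y, G.dist x y + 19 * Fintype.card V : ℕ) : ℚ) ≤
      ((Fintype.card V ^ 3 + 54 : ℕ) : ℚ) := by exact_mod_cast hle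
    rw [Nat.cast_add, Nat.cast_mul, ← hdist, hcard] at hle'
    push_cast at hle'
    have h6W : 6 * wienerIndex G ≤ P := by linarith
    refine ⟨?_, fun heq => ?_, hiso⟩
    · rw [add_le_add_iff_left, div_le_div_iff₀ hP0 hW]
      nlinarith
    · rw [add_right_inj, div_eq_div_iff hW.ne' hP0.ne'] at heq
      have hPW : P = 6 * wienerIndex G := by nlinarith
      refine h.nonempty_iso_Bn1_of_sum_dist_eq hconn ?_ hcard
      have hq : ((3 * ∑ x, ∑ y, G.dist x y + 19 * Fintype.card V : ℕ) : ℚ) =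
          ((Fintype.card V ^ 3 + 54 : ℕ) : ℚ) := by
        rw [Nat.cast_add, Nat.cast_mul, ← hdist, hcard]
        push_cast
        linarith
      exact_mod_cast hq
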